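/- arXiv:2005.10403 — 2 statements merged into one kernel-verified Lean document; each statement's English description precedes it below -/
import Mathlib

section
/- Let ℓ ≥ −1/2, 0 ≤ μ < 1/2 and x > 0. Suppose f : ℝ → ℂ is continuous, integrable, even, vanishes identically outside [−x, x], and there is a constant C₀ > 0 such that its Fourier transform satisfies |f̂(ξ)| ≤ C₀/|ξ|^{ℓ−μ+2} for all ξ ≠ 0. Define h(z) := f(xz)/(1−z²)^{ℓ+1}, c_k := ∫_{−1}^{1} h(z) P̃_k^{(ℓ+1,ℓ+1)}(z) (1−z²)^{ℓ+1} dz, and β̃_n := x · c_{2n}/√(h_{2n}). Then there exists a constant C₁ > 0 (depending on f, x, ℓ, μ) such that |β̃_n| ≤ C₁/n^{ℓ−μ+1/2} for all natural n with 2n > ℓ+1. -/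
open MeasureTheory Set Filter

/-- The Fourier transform `f̂(ξ) = ∫ f(t) e^{-iξt} dt`. -/
noncomputable def fourierT (f : ℝ → ℂ) (ξ : ℝ) : ℂ :=
  ∫ t : ℝ, f t * Complex.exp (-Complex.I * ξ * t)

/-- The Jacobi polynomial `P_n^{(a,b)}` for real parameters `a, b`. -/
noncomputable def jacobiP (a b : ℝ) (n : ℕ) (z : ℝ) : ℝ :=
  (Real.Gamma (a + n + 1) / (n.factorial * Real.Gamma (a + b + n + 1))) *
    ∑ k ∈ Finset.range (n + 1),
      (n.choose k : ℝ) * (Real.Gamma (a + b + n + k + 1) / Real.Gamma (a + k + 1)) *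
        ((z - 1) / 2) ^ k

/-- `h_k = ∫_{-1}^1 (P_k^{(ℓ+1,ℓ+1)})² (1-z²)^{ℓ+1} dz`, the squared weighted norm. -/
noncomputable def jacobiNormSq (l : ℝ) (k : ℕ) : ℝ :=
  (2 ^ (2 * l + 3) / (2 * (k : ℝ) + 2 * l + 3)) * (Real.Gamma ((k : ℝ) + l + 2)) ^ 2 /
    (k.factorial * Real.Gamma ((k : ℝ) + 2 * l + 3))

/-- The normalized Jacobi polynomial `P̃_k^{(ℓ+1,ℓ+1)}`. -/
noncomputable def jacobiPNorm (l : ℝ) (k : ℕ) (z : ℝ) : ℝ :=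
  jacobiP (l + 1) (l + 1) k z / Real.sqrt (jacobiNormSq l k)

/-- The Fourier–Jacobi coefficient `c_k = ∫_{-1}^1 h(z) P̃_k^{(ℓ+1,ℓ+1)}(z) (1-z²)^{ℓ+1} dz`
of `h(z) = f(xz)/(1-z²)^{ℓ+1}`. -/
noncomputable def cJ (l x : ℝ) (f : ℝ → ℂ) (k : ℕ) : ℂ :=
  ∫ z in Set.Ioo (-1 : ℝ) 1,
    (f (x * z) / (((1 - z ^ 2) ^ (l + 1) : ℝ) : ℂ)) *
      (((jacobiPNorm l k z * (1 - z ^ 2) ^ (l + 1)) : ℝ) : ℂ)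


/-- The coefficient `β̃_n = x · c_{2n} / √(h_{2n})`. -/
noncomputable def betaT (l x : ℝ) (f : ℝ → ℂ) (n : ℕ) : ℂ :=
  (x : ℂ) * cJ l x f (2 * n) / ((Real.sqrt (jacobiNormSq l (2 * n)) : ℝ) : ℂ)

/-- Functions on `(0, ∞)` obeying the first-order recurrences of the Bessel functions
`J_ν, J_{ν+1}, …`, and vanishing at the origin. -/
structure BesselSystem (ν : ℝ) (J : ℕ → ℝ → ℝ) : Prop where
  pos : 0 < ν
  zero : ∀ n, J n 0 = 0
  small : ∀ n, ∃ C, ∀ x ∈ Ioc (0 : ℝ) 1, |J n x| ≤ C * x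
  deriv_self : ∀ n x, 0 < x → HasDerivAt (J n) ((ν + n) / x * J n x - J (n + 1) x) x
  deriv_succ : ∀ n x, 0 < x →
    HasDerivAt (J (n + 1)) (J n x - (ν + n + 1) / x * J (n + 1) x) x

namespace BesselSystem

open Asymptotics Topology

variable {ν : ℝ} {J : ℕ → ℝ → ℝ}

theorem continuousOn (h : BesselSystem ν J) (n : ℕ) : ContinuousOn (J n) (Ioi 0) :=
  fun x hx => (h.deriv_self n x hx).continuousAt.continuousWithinAt

theorem continuousWithinAt_zero (h : BesselSystem ν J) (n : ℕ) :
    ContinuousWithinAt (J n) (Ici 0) 0 := by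
  obtain ⟨C, hC⟩ := h.small n
  have h1 : Tendsto (fun x : ℝ => C * x) (𝓝[≥] 0) (𝓝 0) := by
    have : Tendsto (fun x : ℝ => C * x) (𝓝 0) (𝓝 (C * 0)) :=
      (continuous_const.mul continuous_id).tendsto 0
    rw [mul_zero] at this
    exact this.mono_left nhdsWithin_le_nhds
  rw [ContinuousWithinAt, h.zero n]
  refine squeeze_zero_norm' ?_ h1
  filter_upwards [Icc_mem_nhdsGE (zero_lt_one' ℝ)] with x hx
  rcases hx.1.eq_or_lt with rfl | h0
  · simp [h.zero n]
  · exact hC x ⟨h0, hx.2⟩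

theorem add_eq (h : BesselSystem ν J) (n : ℕ) {x : ℝ} (hx : 0 < x) :
    J n x + J (n + 2) x = 2 * (ν + n + 1) / x * J (n + 1) x := by
  have h1 := h.deriv_self (n + 1) x hx
  have h2 := h.deriv_succ n x hx
  have := h1.unique h2
  push_cast at this
  have e : 2 * (ν + n + 1) / x * J (n + 1) x
      = (ν + (n + 1)) / x * J (n + 1) x + (ν + n + 1) / x * J (n + 1) x := by ring
  rw [e]
  linarith

theorem exists_sq_le (h : BesselSystem ν J) (n : ℕ) :
    ∃ C, ∀ x, 2 * (ν + n) + 1 ≤ x → x * (J n x ^ 2 + J (n + 1) x ^ 2) ≤ C := by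
  set c : ℝ := 2 * (ν + n) + 1 with hc
  have hν := h.pos
  have hc1 : 1 < c := by
    have : (0 : ℝ) ≤ n := n.cast_nonneg
    rw [hc]; linarith
  set e : ℝ → ℝ := fun x => x * (J n x ^ 2 + J (n + 1) x ^ 2) - c * (J n x * J (n + 1) x) with he
  have hde : ∀ x, 0 < x → HasDerivAt e (c * (J n x * J (n + 1) x) / x) x := by
    intro x hx
    have h1 := h.deriv_self n x hx
    have h2 := h.deriv_succ n x hx
    have h3 := ((hasDerivAt_id x).mul ((h1.pow 2).add (h2.pow 2))).sub ((h1.mul h2).const_mul c)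
    refine h3.congr_deriv ?_
    simp only [id, Pi.add_apply, Pi.pow_apply, hc]
    field_simp
    ring
  have hpos : ∀ x, c ≤ x → x / 2 * (J n x ^ 2 + J (n + 1) x ^ 2) ≤ e x := by
    intro x hx
    simp only [he]
    nlinarith [sq_nonneg (J n x - J (n + 1) x), sq_nonneg (J n x), sq_nonneg (J (n + 1) x),
      mul_nonneg (sub_nonneg.2 hx) (sq_nonneg (J n x)),
      mul_nonneg (sub_nonneg.2 hx) (sq_nonneg (J (n + 1) x)),
      mul_nonneg (by linarith : (0 : ℝ) ≤ c) (sq_nonneg (J n x - J (n + 1) x))]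
  have hanti : AntitoneOn (fun x => e x * Real.exp (c / x)) (Ici c) := by
    have hd : ∀ x ∈ Ici c, HasDerivAt (fun x => e x * Real.exp (c / x))
        (c * (J n x * J (n + 1) x) / x * Real.exp (c / x)
          + e x * (Real.exp (c / x) * (-c / x ^ 2))) x := by
      intro x hx
      have hx0 : 0 < x := by have : c ≤ x := hx; linarith
      have h1 : HasDerivAt (fun x : ℝ => c / x) (-c / x ^ 2) x := by
        simpa only [div_eq_mul_inv, neg_mul, mul_neg] using (hasDerivAt_inv hx0.ne').const_mul c
      exact (hde x hx0).mul h1.exp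
    refine antitoneOn_of_hasDerivWithinAt_nonpos (convex_Ici c)
      (fun x hx => (hd x hx).continuousAt.continuousWithinAt)
      (fun x hx => (hd x (interior_subset hx)).hasDerivWithinAt) ?_
    intro x hx
    have hx' : c ≤ x := interior_subset hx
    have hx0 : 0 < x := by linarith
    have h1 := hpos x hx'
    have h2 : c * (J n x * J (n + 1) x) / x + e x * (-c / x ^ 2) ≤ 0 := by
      have : c * (J n x * J (n + 1) x) / x + e x * (-c / x ^ 2)
          = c / x ^ 2 * (x * (J n x * J (n + 1) x) - e x) := by field_simp; rw [sub_eq_add_neg]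
      rw [this]
      refine mul_nonpos_of_nonneg_of_nonpos (by positivity) ?_
      nlinarith [mul_nonneg hx0.le (sq_nonneg (J n x - J (n + 1) x))]
    nlinarith [Real.exp_pos (c / x)]
  refine ⟨2 * (e c * Real.exp (c / c)), fun x hx => ?_⟩
  have hx0 : 0 < x := by linarith
  have h1 := hanti (mem_Ici.2 le_rfl) (mem_Ici.2 hx) hx
  have h2 := hpos x hx
  have h3 : 1 ≤ Real.exp (c / x) := Real.one_le_exp (by positivity)
  have h4 : 0 ≤ e x := le_trans (by positivity) h2
  simp only at h1
  nlinarith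

theorem isBigO (h : BesselSystem ν J) (n : ℕ) : J n =O[atTop] fun x : ℝ => x ^ (-(1 / 2) : ℝ) := by
  obtain ⟨C, hC⟩ := h.exists_sq_le n
  refine IsBigO.of_bound (Real.sqrt C) ?_
  filter_upwards [eventually_ge_atTop (2 * (ν + n) + 1), eventually_gt_atTop 0] with x hx hx0
  have h1 := hC x hx
  rw [Real.norm_eq_abs, Real.norm_of_nonneg (by positivity), Real.rpow_neg hx0.le,
    ← Real.sqrt_eq_rpow, ← div_eq_mul_inv, ← Real.sqrt_div' _ hx0.le]
  refine Real.abs_le_sqrt ?_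
  rw [le_div_iff₀ hx0]
  nlinarith [mul_nonneg hx0.le (sq_nonneg (J (n + 1) x))]

theorem tendsto_zero (h : BesselSystem ν J) (n : ℕ) : Tendsto (J n) atTop (𝓝 0) :=
  (h.isBigO n).trans_tendsto (tendsto_rpow_neg_atTop (by norm_num))

theorem isBigO_add (h : BesselSystem ν J) (n : ℕ) :
    (fun x => J n x + J (n + 2) x) =O[atTop] fun x : ℝ => x ^ (-(3 / 2) : ℝ) := by
  have h1 : (fun x : ℝ => 2 * (ν + n + 1) / x) =O[atTop] fun x : ℝ => x ^ (-1 : ℝ) := by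
    simp only [div_eq_mul_inv, Real.rpow_neg_one]
    exact (isBigO_refl _ _).const_mul_left _
  refine (h1.mul (h.isBigO (n + 1))).congr' ?_ ?_
  · filter_upwards [eventually_gt_atTop 0] with x hx
    exact (h.add_eq n hx).symm
  · filter_upwards [eventually_gt_atTop 0] with x hx
    rw [← Real.rpow_add hx]
    norm_num

theorem isBigO_sub (h : BesselSystem ν J) (n p : ℕ) :
    (fun x => J (n + 2 * p) x - (-1) ^ p * J n x) =O[atTop] fun x : ℝ => x ^ (-(3 / 2) : ℝ) := by
  induction p with
  | zero => simpa using isBigO_zero _ _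
  | succ p ih =>
    refine ((h.isBigO_add (n + 2 * p)).sub ih).congr_left fun x => ?_
    rw [show n + 2 * (p + 1) = n + 2 * p + 2 by ring, pow_succ]
    ring

theorem integrableOn (h : BesselSystem ν J) (m n : ℕ) :
    IntegrableOn (fun x => J m x * J n x / x) (Ioi 0) := by
  have hcont : ContinuousOn (fun x => J m x * J n x / x) (Ioi 0) :=
    ((h.continuousOn m).mul (h.continuousOn n)).div continuousOn_id fun x hx => (ne_of_gt hx)
  rw [← Ioc_union_Ioi_eq_Ioi (zero_le_one' ℝ)]
  refine IntegrableOn.union ?_ ?_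
  · obtain ⟨C, hC⟩ := h.small m
    obtain ⟨D, hD⟩ := h.small n
    refine IntegrableOn.of_bound (C := C * D) (by simp)
      ((hcont.mono Ioc_subset_Ioi_self).aestronglyMeasurable measurableSet_Ioc) ?_
    filter_upwards [ae_restrict_mem measurableSet_Ioc] with x hx
    have hx0 := hx.1
    have h1 := hC x hx
    have h2 := hD x hx
    have hC0 : 0 ≤ C := by
      by_contra hneg
      nlinarith [abs_nonneg (J m x)]
    rw [norm_div, norm_mul, Real.norm_eq_abs, Real.norm_eq_abs, Real.norm_of_nonneg hx0.le,
      div_le_iff₀ hx0]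
    calc |J m x| * |J n x| ≤ (C * x) * (D * x) := by gcongr
      _ = C * D * x * x := by ring
      _ ≤ C * D * x := by
        have : 0 ≤ C * D * x := by
          have : 0 ≤ D * x := (abs_nonneg _).trans h2
          rw [mul_assoc]; positivity
        nlinarith [hx.2]
  · have hO : (fun x => J m x * J n x / x) =O[atTop] fun x : ℝ => x ^ (-2 : ℝ) := by
      have h1 : (fun x : ℝ => x⁻¹) =O[atTop] fun x : ℝ => x ^ (-1 : ℝ) := by
        simp only [Real.rpow_neg_one]
        exact isBigO_refl _ _
      refine (((h.isBigO m).mul (h.isBigO n)).mul h1).congr' ?_ ?_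
      · exact Eventually.of_forall fun x => (div_eq_mul_inv _ _).symm
      · filter_upwards [eventually_gt_atTop 0] with x hx
        rw [← Real.rpow_add hx, ← Real.rpow_add hx]
        norm_num
    have hloc : LocallyIntegrableOn (fun x => J m x * J n x / x) (Ici 1) :=
      (hcont.mono (Ici_subset_Ioi.2 zero_lt_one)).locallyIntegrableOn
        measurableSet_Ici
    refine (hloc.integrableOn_of_isBigO_atTop hO ?_).mono_set Ioi_subset_Ici_self
    exact ⟨Ioi 1, Ioi_mem_atTop 1, integrableOn_Ioi_rpow_of_lt (by norm_num) zero_lt_one⟩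

theorem integral_eq_zero (h : BesselSystem ν J) (n p : ℕ) (hp : p ≠ 0) :
    ∫ x in Ioi 0, J (n + 2 * p) x * J n x / x = 0 := by
  set m := n + 2 * p with hm
  set W : ℝ → ℝ := fun x => x * (J (m + 1) x * J n x - J m x * J (n + 1) x)
    - ((m : ℝ) - n) * (J m x * J n x) with hW
  set c : ℝ := -((ν + m) ^ 2 - (ν + n) ^ 2) with hc
  have hd : ∀ x ∈ Ioi (0 : ℝ), HasDerivAt W (c * (J m x * J n x / x)) x := by
    intro x hx
    have hx0 : (0 : ℝ) < x := hx
    have a1 := h.deriv_self m x hx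
    have a2 := h.deriv_succ m x hx
    have b1 := h.deriv_self n x hx
    have b2 := h.deriv_succ n x hx
    refine (((hasDerivAt_id x).mul ((a2.mul b1).sub (a1.mul b2))).sub
      ((a1.mul b1).const_mul ((m : ℝ) - n))).congr_deriv ?_
    simp only [id, hc, Pi.sub_apply, Pi.mul_apply]
    field_simp
    ring
  have hcont : ContinuousWithinAt W (Ici 0) 0 := by
    have c1 := h.continuousWithinAt_zero m
    have c2 := h.continuousWithinAt_zero (m + 1)
    have c3 := h.continuousWithinAt_zero n
    have c4 := h.continuousWithinAt_zero (n + 1)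
    exact (continuousWithinAt_id.mul ((c2.mul c3).sub (c1.mul c4))).sub
      (continuousWithinAt_const.mul (c1.mul c3))
  have hlim : Tendsto W atTop (𝓝 0) := by
    have e : ∀ x, W x = x * ((J (n + 1 + 2 * p) x - (-1) ^ p * J (n + 1) x) * J n x
        - (J (n + 2 * p) x - (-1) ^ p * J n x) * J (n + 1) x)
        - ((m : ℝ) - n) * (J m x * J n x) := by
      intro x
      simp only [hW]
      rw [show n + 1 + 2 * p = m + 1 by omega, ← hm]
      ring
    have hx : (fun x : ℝ => x) =O[atTop] fun x : ℝ => x ^ (1 : ℝ) := by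
      simp only [Real.rpow_one]; exact isBigO_refl _ _
    have hE : ∀ x : ℝ, 0 < x →
        x ^ (1 : ℝ) * (x ^ (-(3 / 2) : ℝ) * x ^ (-(1 / 2) : ℝ)) = x ^ (-1 : ℝ) := by
      intro x hx
      rw [← Real.rpow_add hx, ← Real.rpow_add hx]
      norm_num
    have h1 : (fun x => x * ((J (n + 1 + 2 * p) x - (-1) ^ p * J (n + 1) x) * J n x
        - (J (n + 2 * p) x - (-1) ^ p * J n x) * J (n + 1) x)) =O[atTop]
        fun x : ℝ => x ^ (-1 : ℝ) := by
      refine (hx.mul (((h.isBigO_sub (n + 1) p).mul (h.isBigO n)).sub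
        ((h.isBigO_sub n p).mul (h.isBigO (n + 1))))).congr' EventuallyEq.rfl ?_
      filter_upwards [eventually_gt_atTop 0] with x hx0
      exact hE x hx0
    have h2 := h1.trans_tendsto (tendsto_rpow_neg_atTop zero_lt_one)
    have h3 := h2.sub (((h.tendsto_zero m).mul (h.tendsto_zero n)).const_mul ((m : ℝ) - n))
    simp only [mul_zero, sub_zero] at h3
    exact h3.congr fun x => (e x).symm
  have := integral_Ioi_of_hasDerivAt_of_tendsto hcont hd ((h.integrableOn m n).const_mul c) hlim
  have hW0 : W 0 = 0 := by simp [hW, h.zero]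
  rw [integral_const_mul, hW0, sub_zero] at this
  refine (mul_eq_zero.1 this).resolve_left ?_
  have hν := h.pos
  have hp' : (0 : ℝ) < p := by exact_mod_cast Nat.pos_of_ne_zero hp
  have hn : (0 : ℝ) ≤ n := n.cast_nonneg
  rw [hc, hm]
  push_cast
  have : 0 < (ν + (n + 2 * p)) ^ 2 - (ν + n) ^ 2 := by nlinarith
  linarith

theorem integral_even_shift_eq_zero (h : BesselSystem ν J) {j k : ℕ} (hj : Even j) (hk : Even k)
    (hjk : j ≠ k) : ∫ x in Ioi 0, J j x * J k x / x = 0 := by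
  obtain ⟨a, rfl⟩ := hj
  obtain ⟨b, rfl⟩ := hk
  rcases lt_or_gt_of_ne hjk with hlt | hlt
  · obtain ⟨p, rfl⟩ := Nat.exists_eq_add_of_lt (show a < b by omega)
    have := h.integral_eq_zero (a + a) (p + 1) (by omega)
    rw [show a + p + 1 + (a + p + 1) = a + a + 2 * (p + 1) by ring]
    simpa only [mul_comm (J (a + a) _)] using this
  · obtain ⟨p, rfl⟩ := Nat.exists_eq_add_of_lt (show b < a by omega)
    have := h.integral_eq_zero (b + b) (p + 1) (by omega)
    rwa [show b + p + 1 + (b + p + 1) = b + b + 2 * (p + 1) by ring]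

theorem integral_sq_aux (h : BesselSystem ν J) (n : ℕ) {X : ℝ} (hX : 0 ≤ X) :
    2 * ((ν + n) * ∫ x in Ioi X, J n x * J n x / x)
      - 2 * ((ν + n + 1) * ∫ x in Ioi X, J (n + 1) x * J (n + 1) x / x)
      = - (J n X ^ 2 + J (n + 1) X ^ 2) := by
  have hsub : Ioi X ⊆ Ioi 0 := Ioi_subset_Ioi hX
  have i1 := (h.integrableOn n n).mono_set hsub
  have i2 := (h.integrableOn (n + 1) (n + 1)).mono_set hsub
  have hd : ∀ x ∈ Ioi X, HasDerivAt (fun x => J n x ^ 2 + J (n + 1) x ^ 2)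
      (2 * ((ν + n) * (J n x * J n x / x))
        - 2 * ((ν + n + 1) * (J (n + 1) x * J (n + 1) x / x))) x := by
    intro x hx
    have hx0 : (0 : ℝ) < x := hsub hx
    refine (((h.deriv_self n x hx0).pow 2).add ((h.deriv_succ n x hx0).pow 2)).congr_deriv ?_
    field_simp
    ring
  have hlim : Tendsto (fun x => J n x ^ 2 + J (n + 1) x ^ 2) atTop (𝓝 0) := by
    simpa using ((h.tendsto_zero n).pow 2).add ((h.tendsto_zero (n + 1)).pow 2)
  have hcont : ∀ n, ContinuousWithinAt (J n) (Ici X) X := fun n => by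
    rcases hX.eq_or_lt with rfl | hX
    · exact h.continuousWithinAt_zero n
    · exact (h.deriv_self n X hX).continuousAt.continuousWithinAt
  have := integral_Ioi_of_hasDerivAt_of_tendsto (((hcont n).pow 2).add ((hcont (n + 1)).pow 2)) hd
    (((i1.const_mul _).const_mul _).sub ((i2.const_mul _).const_mul _)) hlim
  rw [integral_sub ((i1.const_mul _).const_mul _) ((i2.const_mul _).const_mul _)] at this
  simp only [integral_const_mul] at this
  rw [this]
  simp

theorem integral_sq (h : BesselSystem ν J) (n : ℕ) :
    (ν + n) * ∫ x in Ioi 0, J n x * J n x / x = ν * ∫ x in Ioi 0, J 0 x * J 0 x / x := by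
  induction n with
  | zero => simp
  | succ n ih =>
    have := h.integral_sq_aux n le_rfl
    simp only [h.zero] at this
    push_cast
    rw [← add_assoc]
    linarith

theorem sq_le (h : BesselSystem ν J) (n : ℕ) {x : ℝ} (hx : 0 < x) :
    J n x ^ 2 ≤ 2 * (ν * ∫ x in Ioi 0, J 0 x * J 0 x / x) := by
  have h1 := h.integral_sq_aux n hx.le
  have h2 := h.integral_sq (n + 1)
  have hν := h.pos
  have nn : ∀ n, ∀ y ∈ Ioi (0 : ℝ), 0 ≤ J n y * J n y / y := fun n y hy =>
    div_nonneg (mul_self_nonneg _) (le_of_lt hy)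
  have h3 : ∫ y in Ioi x, J (n + 1) y * J (n + 1) y / y
      ≤ ∫ y in Ioi 0, J (n + 1) y * J (n + 1) y / y :=
    setIntegral_mono_set (h.integrableOn _ _)
      ((ae_restrict_mem measurableSet_Ioi).mono fun y hy => nn _ y hy)
      (Ioi_subset_Ioi hx.le).eventuallyLE
  have h4 : 0 ≤ ∫ y in Ioi x, J n y * J n y / y :=
    setIntegral_nonneg measurableSet_Ioi fun y hy => nn _ y (hx.trans hy)
  push_cast at h2
  rw [← add_assoc] at h2
  have h5 : (ν + n + 1) * ∫ y in Ioi x, J (n + 1) y * J (n + 1) y / y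
      ≤ ν * ∫ x in Ioi 0, J 0 x * J 0 x / x := by
    rw [← h2]
    gcongr
  have h6 : 0 ≤ (ν + n) * ∫ y in Ioi x, J n y * J n y / y := by positivity
  nlinarith [sq_nonneg (J (n + 1) x)]

theorem exists_abs_le (h : BesselSystem ν J) :
    ∃ C, 0 ≤ C ∧ ∀ n x, 0 < x → |J n x| ≤ C := by
  refine ⟨Real.sqrt (2 * (ν * ∫ x in Ioi 0, J 0 x * J 0 x / x)), Real.sqrt_nonneg _,
    fun n x hx => ?_⟩
  exact Real.abs_le_sqrt (h.sq_le n hx)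

theorem abs_le_mul (h : BesselSystem ν J) {C : ℝ} (hC : ∀ n x, 0 < x → |J n x| ≤ C) {k : ℕ}
    (hk : 2 ≤ k) {x : ℝ} (hx : 0 < x) : |J k x| ≤ C * (x / (ν + k)) := by
  obtain ⟨n, rfl⟩ := Nat.exists_eq_add_of_le' (show 1 ≤ k by omega)
  have hν := h.pos
  have h1 := h.add_eq n hx
  have h2 : J (n + 1) x = (J n x + J (n + 2) x) / 2 * (x / (ν + (n + 1 : ℕ))) := by
    rw [h1]
    push_cast
    field_simp
    ring
  rw [h2, abs_mul, abs_of_nonneg (by positivity : 0 ≤ x / (ν + (n + 1 : ℕ)))]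
  gcongr
  rw [abs_div, abs_two]
  have := abs_add_le (J n x) (J (n + 2) x)
  have := hC n x hx
  have := hC (n + 2) x hx
  linarith

/-- The key estimate `∫₀^∞ x^{μ-3/2} |J_{ν+k}(x)| dx = O(k^{μ-1/2})`. -/
theorem integrableOn_rpow_and_integral_le (h : BesselSystem ν J) {C : ℝ}
    (hC : ∀ n x, 0 < x → |J n x| ≤ C) {k : ℕ} (hk : 2 ≤ k) {μ : ℝ} (hμ0 : 0 ≤ μ) (hμ : μ < 1 / 2) :
    IntegrableOn (fun x => x ^ (μ - 3 / 2) * |J k x|) (Ioi 0) ∧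
    ∫ x in Ioi 0, x ^ (μ - 3 / 2) * |J k x|
      ≤ C * (1 / (μ + 1 / 2) + 1 / (1 / 2 - μ)) * (ν + k) ^ (μ - 1 / 2) := by
  set a : ℝ := ν + k with ha
  have ha0 : 0 < a := by have := h.pos; positivity
  have hcont : ContinuousOn (fun x => x ^ (μ - 3 / 2) * |J k x|) (Ioi 0) :=
    (continuousOn_id.rpow_const fun x hx => Or.inl (ne_of_gt hx)).mul (h.continuousOn k).abs
  have i1 : IntegrableOn (fun x : ℝ => C / a * x ^ (μ - 1 / 2)) (Ioc 0 a) := by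
    refine Integrable.const_mul ?_ _
    rw [← IntegrableOn, ← intervalIntegrable_iff_integrableOn_Ioc_of_le ha0.le]
    exact intervalIntegral.intervalIntegrable_rpow' (by linarith)
  have i2 : IntegrableOn (fun x : ℝ => C * x ^ (μ - 3 / 2)) (Ioi a) :=
    (integrableOn_Ioi_rpow_of_lt (by linarith) ha0).const_mul _
  have b1 : ∀ x ∈ Ioc 0 a, x ^ (μ - 3 / 2) * |J k x| ≤ C / a * x ^ (μ - 1 / 2) := by
    intro x hx
    have := h.abs_le_mul hC hk hx.1
    calc x ^ (μ - 3 / 2) * |J k x| ≤ x ^ (μ - 3 / 2) * (C * (x / a)) := by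
          have := hx.1
          gcongr
      _ = C / a * (x ^ (μ - 3 / 2) * x) := by ring
      _ = C / a * x ^ (μ - 1 / 2) := by
          rw [← Real.rpow_add_one hx.1.ne']
          norm_num
          left
          congr 1
          ring
  have b2 : ∀ x ∈ Ioi a, x ^ (μ - 3 / 2) * |J k x| ≤ C * x ^ (μ - 3 / 2) := by
    intro x hx
    have hx0 : 0 < x := ha0.trans hx
    rw [mul_comm]
    gcongr
    exact hC k x hx0
  have nn : ∀ x ∈ Ioi (0 : ℝ), 0 ≤ x ^ (μ - 3 / 2) * |J k x| := fun x hx => by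
    have : (0 : ℝ) < x := hx
    positivity
  have j1 : IntegrableOn (fun x => x ^ (μ - 3 / 2) * |J k x|) (Ioc 0 a) := by
    refine Integrable.mono' i1 ((hcont.mono Ioc_subset_Ioi_self).aestronglyMeasurable
      measurableSet_Ioc) ?_
    filter_upwards [ae_restrict_mem measurableSet_Ioc] with x hx
    rw [Real.norm_of_nonneg (nn x hx.1)]
    exact b1 x hx
  have j2 : IntegrableOn (fun x => x ^ (μ - 3 / 2) * |J k x|) (Ioi a) := by
    refine Integrable.mono' i2 ((hcont.mono (Ioi_subset_Ioi ha0.le)).aestronglyMeasurable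
      measurableSet_Ioi) ?_
    filter_upwards [ae_restrict_mem measurableSet_Ioi] with x hx
    rw [Real.norm_of_nonneg (nn x (ha0.trans hx))]
    exact b2 x hx
  rw [← Ioc_union_Ioi_eq_Ioi ha0.le]
  refine ⟨j1.union j2, ?_⟩
  rw [setIntegral_union (Ioc_disjoint_Ioi le_rfl) measurableSet_Ioi j1 j2]
  have k1 := setIntegral_mono_on j1 i1 measurableSet_Ioc b1
  have k2 := setIntegral_mono_on j2 i2 measurableSet_Ioi b2
  rw [integral_const_mul,
    ← intervalIntegral.integral_of_le (f := fun x : ℝ => x ^ (μ - 1 / 2)) ha0.le,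
    integral_rpow (Or.inl (by linarith)), Real.zero_rpow (by linarith)] at k1
  rw [integral_const_mul, integral_Ioi_rpow_of_lt (by linarith) ha0] at k2
  have e1 : C / a * ((a ^ (μ - 1 / 2 + 1) - 0) / (μ - 1 / 2 + 1))
      = C * (1 / (μ + 1 / 2)) * a ^ (μ - 1 / 2) := by
    rw [Real.rpow_add_one ha0.ne', sub_zero, show μ - 1 / 2 + 1 = μ + 1 / 2 by ring]
    field_simp
  have e2 : C * (-a ^ (μ - 3 / 2 + 1) / (μ - 3 / 2 + 1))
      = C * (1 / (1 / 2 - μ)) * a ^ (μ - 1 / 2) := by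
    rw [show μ - 3 / 2 + 1 = μ - 1 / 2 by ring, show (μ - 1 / 2 : ℝ) = -(1 / 2 - μ) by ring,
      neg_div_neg_eq]
    ring
  rw [e1] at k1
  rw [e2] at k2
  calc _ ≤ _ := add_le_add k1 k2
    _ = _ := by ring

end BesselSystem

/-- Integration against the Gegenbauer weight `(1 - z²)^β` on `[-1, 1]`. -/
noncomputable def wInt (β : ℝ) (F : ℝ → ℝ) : ℝ :=
  ∫ z in (-1 : ℝ)..1, (1 - z ^ 2) ^ β * F z

theorem continuous_weight {β : ℝ} (hβ : 0 ≤ β) : Continuous fun z : ℝ => (1 - z ^ 2) ^ β :=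
  (continuous_const.sub (continuous_pow 2)).rpow_const fun _ => Or.inr hβ

theorem one_sub_sq_mem {z : ℝ} (hz : z ∈ Icc (-1 : ℝ) 1) : 1 - z ^ 2 ∈ Icc (0 : ℝ) 1 :=
  ⟨by nlinarith [hz.1, hz.2], by nlinarith [sq_nonneg z]⟩

theorem weight_nonneg {β z : ℝ} (hz : z ∈ Icc (-1 : ℝ) 1) : 0 ≤ (1 - z ^ 2) ^ β :=
  Real.rpow_nonneg (one_sub_sq_mem hz).1 β

theorem weight_le_one {β z : ℝ} (hβ : 0 ≤ β) (hz : z ∈ Icc (-1 : ℝ) 1) :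
    (1 - z ^ 2) ^ β ≤ 1 :=
  Real.rpow_le_one (one_sub_sq_mem hz).1 (one_sub_sq_mem hz).2 hβ

section wInt

variable {β : ℝ} {F G : ℝ → ℝ}

theorem intervalIntegrable_weight_mul (hβ : 0 ≤ β) (hF : Continuous F) (a b : ℝ) :
    IntervalIntegrable (fun z => (1 - z ^ 2) ^ β * F z) volume a b :=
  ((continuous_weight hβ).mul hF).intervalIntegrable a b

theorem wInt_add (hβ : 0 ≤ β) (hF : Continuous F) (hG : Continuous G) :
    wInt β (fun z => F z + G z) = wInt β F + wInt β G := by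
  simp only [wInt, mul_add]
  exact intervalIntegral.integral_add (intervalIntegrable_weight_mul hβ hF _ _)
    (intervalIntegrable_weight_mul hβ hG _ _)

theorem wInt_sub (hβ : 0 ≤ β) (hF : Continuous F) (hG : Continuous G) :
    wInt β (fun z => F z - G z) = wInt β F - wInt β G := by
  simp only [wInt, mul_sub]
  exact intervalIntegral.integral_sub (intervalIntegrable_weight_mul hβ hF _ _)
    (intervalIntegrable_weight_mul hβ hG _ _)

theorem wInt_const_mul (c : ℝ) : wInt β (fun z => c * F z) = c * wInt β F := by
  rw [wInt, wInt, ← intervalIntegral.integral_const_mul]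
  congr 1; ext z; ring

theorem wInt_one_sub_sq_mul (hβ : 0 ≤ β) :
    wInt β (fun z => (1 - z ^ 2) * F z) = wInt (β + 1) F := by
  refine intervalIntegral.integral_congr fun z hz => ?_
  rw [uIcc_of_le (by norm_num)] at hz
  have := Real.rpow_add_one' (one_sub_sq_mem hz).1 (y := β) (by linarith)
  simp only [this]; ring

theorem abs_wInt_le (hβ : 0 ≤ β) {C : ℝ} (h : ∀ z ∈ Icc (-1 : ℝ) 1, |F z| ≤ C) :
    |wInt β F| ≤ 2 * C := by
  have := intervalIntegral.norm_integral_le_of_norm_le_const (a := (-1 : ℝ)) (b := 1)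
    (f := fun z => (1 - z ^ 2) ^ β * F z) (C := C) (fun z hz => by
      rw [uIoc_of_le (by norm_num)] at hz
      have hz' := Ioc_subset_Icc_self hz
      rw [norm_mul, Real.norm_of_nonneg (weight_nonneg hz'), Real.norm_eq_abs]
      calc _ ≤ 1 * |F z| :=
            mul_le_mul_of_nonneg_right (weight_le_one hβ hz') (abs_nonneg _)
        _ ≤ C := by rw [one_mul]; exact h z hz')
  rw [Real.norm_eq_abs] at this
  norm_num at this
  rw [wInt]; linarith

theorem wInt_pos (hβ : 0 ≤ β) (hF : Continuous F) (h0 : ∀ z ∈ Ioo (-1 : ℝ) 1, 0 ≤ F z)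
    {z₀ : ℝ} (hz₀ : z₀ ∈ Ioo (-1 : ℝ) 1) (hpos : 0 < F z₀) : 0 < wInt β F := by
  refine intervalIntegral.integral_pos (by norm_num)
    ((continuous_weight hβ).mul hF).continuousOn (fun z hz => ?_) ⟨z₀, Ioo_subset_Icc_self hz₀, ?_⟩
  · rcases hz.2.eq_or_lt with rfl | h
    · rcases hβ.eq_or_lt with rfl | hb
      · simp only [Real.rpow_zero, one_mul]
        refine ge_of_tendsto (hF.continuousAt.tendsto.mono_left
          (nhdsWithin_le_nhds (s := Iio 1))) ?_
        filter_upwards [Ioo_mem_nhdsLT (show (-1 : ℝ) < 1 by norm_num)] with z hz using h0 z hz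
      · simp [Real.zero_rpow hb.ne']
    · exact mul_nonneg (weight_nonneg (Ioc_subset_Icc_self hz)) (h0 z ⟨hz.1, h⟩)
  · exact mul_pos (Real.rpow_pos_of_pos (by nlinarith [hz₀.1, hz₀.2]) _) hpos

theorem hasDerivAt_weight (hβ : 0 ≤ β) (z : ℝ) :
    HasDerivAt (fun z : ℝ => (1 - z ^ 2) ^ (β + 1)) (-(2 * (β + 1)) * z * (1 - z ^ 2) ^ β) z := by
  have h1 : HasDerivAt (fun z : ℝ => 1 - z ^ 2) (-(2 * z)) z := by
    simpa using (hasDerivAt_pow 2 z).const_sub 1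
  have := h1.rpow_const (p := β + 1) (Or.inr (by linarith))
  convert this using 1
  rw [add_sub_cancel_right]; ring

theorem wInt_deriv {F' : ℝ → ℝ} (hβ : 0 ≤ β) (hF : ∀ z, HasDerivAt F (F' z) z)
    (hF' : Continuous F') : wInt (β + 1) F' = 2 * (β + 1) * wInt β (fun z => z * F z) := by
  have hFc : Continuous F := continuous_iff_continuousAt.2 fun z => (hF z).continuousAt
  have h1 : ∀ z ∈ uIcc (-1 : ℝ) 1, HasDerivAt (fun z => (1 - z ^ 2) ^ (β + 1) * F z)
      ((1 - z ^ 2) ^ (β + 1) * F' z - 2 * (β + 1) * ((1 - z ^ 2) ^ β * (z * F z))) z := by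
    intro z _
    refine ((hasDerivAt_weight hβ z).mul (hF z)).congr_deriv ?_
    ring
  have i1 := intervalIntegrable_weight_mul (β := β + 1) (by linarith) hF' (-1) 1
  have i2 := (intervalIntegrable_weight_mul hβ (continuous_id.mul hFc) (-1) 1).const_mul
    (2 * (β + 1))
  have h2 := intervalIntegral.integral_eq_sub_of_hasDerivAt h1 (i1.sub i2)
  have h3 := intervalIntegral.integral_sub i1 i2
  simp only [Pi.mul_apply, id] at h3
  rw [h3, intervalIntegral.integral_const_mul] at h2
  have h0 : (0 : ℝ) ^ (β + 1) = 0 := Real.zero_rpow (by linarith)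
  norm_num [h0] at h2
  rw [wInt, wInt]
  linarith

end wInt

/-- The cosine transform of the weight `(1 - z²)^β` on `[-1, 1]`. -/
noncomputable def cosInt (β ξ : ℝ) : ℝ := wInt β fun z => Real.cos (ξ * z)

theorem hasDerivAt_cosInt {β : ℝ} (hβ : 0 ≤ β) (ξ : ℝ) :
    HasDerivAt (cosInt β) (-(ξ / (2 * (β + 1))) * cosInt (β + 1) ξ) ξ := by
  have h1 : HasDerivAt (cosInt β)
      (∫ z in (-1 : ℝ)..1, (1 - z ^ 2) ^ β * (-Real.sin (ξ * z) * z)) ξ := by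
    refine (intervalIntegral.hasDerivAt_integral_of_dominated_loc_of_deriv_le
      (F := fun ξ z => (1 - z ^ 2) ^ β * Real.cos (ξ * z))
      (F' := fun ξ z => (1 - z ^ 2) ^ β * (-Real.sin (ξ * z) * z))
      (bound := fun _ => 1) (s := univ) univ_mem ?_ ?_ ?_ ?_ ?_ ?_).2
    · exact Eventually.of_forall fun ξ => ((continuous_weight hβ).mul
        (by fun_prop)).aestronglyMeasurable
    · exact intervalIntegrable_weight_mul hβ (by fun_prop) _ _
    · exact ((continuous_weight hβ).mul (by fun_prop)).aestronglyMeasurable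
    · refine Eventually.of_forall fun z hz ξ _ => ?_
      rw [uIoc_of_le (by norm_num)] at hz
      have hz' := Ioc_subset_Icc_self hz
      rw [norm_mul, norm_mul, norm_neg, Real.norm_of_nonneg (weight_nonneg hz')]
      have a1 := weight_le_one hβ hz'
      have a2 : ‖Real.sin (ξ * z)‖ ≤ 1 := Real.abs_sin_le_one _
      have a3 : ‖z‖ ≤ 1 := abs_le.2 hz'
      exact mul_le_one₀ a1 (by positivity) (mul_le_one₀ a2 (norm_nonneg _) a3)
    · exact intervalIntegrable_const
    · refine Eventually.of_forall fun z _ ξ _ => ?_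
      have : HasDerivAt (fun ξ : ℝ => ξ * z) z ξ := by simpa using (hasDerivAt_id ξ).mul_const z
      exact this.cos.const_mul _
  have h2 := wInt_deriv (F := fun z => Real.sin (ξ * z)) (F' := fun z => ξ * Real.cos (ξ * z)) hβ
    (fun z => by
      have : HasDerivAt (fun z : ℝ => ξ * z) ξ z := by simpa using (hasDerivAt_id z).const_mul ξ
      simpa [mul_comm] using this.sin) (by fun_prop)
  rw [wInt_const_mul] at h2
  have h3 : (∫ z in (-1 : ℝ)..1, (1 - z ^ 2) ^ β * (-Real.sin (ξ * z) * z))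
      = -wInt β (fun z => z * Real.sin (ξ * z)) := by
    rw [wInt, ← intervalIntegral.integral_neg]
    congr 1; ext z; ring
  convert h1 using 1
  rw [h3, cosInt]
  have : β + 1 ≠ 0 := by linarith
  field_simp
  linarith

theorem cosInt_add_one {β : ℝ} (hβ : 0 ≤ β) (ξ : ℝ) :
    ξ * (-(ξ / (2 * (β + 2))) * cosInt (β + 2) ξ) + (2 * β + 3) * cosInt (β + 1) ξ
      = 2 * (β + 1) * cosInt β ξ := by
  have hd := wInt_deriv (β := β + 1) (F := fun z => Real.sin (ξ * z))
    (F' := fun z => ξ * Real.cos (ξ * z)) (by linarith)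
    (fun z => by
      have : HasDerivAt (fun z : ℝ => ξ * z) ξ z := by simpa using (hasDerivAt_id z).const_mul ξ
      simpa [mul_comm] using this.sin) (by fun_prop)
  rw [wInt_const_mul, show β + 1 + 1 = β + 2 by ring] at hd
  have he := wInt_deriv (β := β) (F := fun z => z * Real.cos (ξ * z))
    (F' := fun z => Real.cos (ξ * z) - ξ * (z * Real.sin (ξ * z))) hβ
    (fun z => by
      have : HasDerivAt (fun z : ℝ => ξ * z) ξ z := by simpa using (hasDerivAt_id z).const_mul ξ
      refine ((hasDerivAt_id z).mul this.cos).congr_deriv ?_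
      simp only [id]; ring) (by fun_prop)
  rw [wInt_sub (by linarith) (by fun_prop) (by fun_prop), wInt_const_mul] at he
  have hf : wInt β (fun z => z * (z * Real.cos (ξ * z))) = cosInt β ξ - cosInt (β + 1) ξ := by
    rw [cosInt, cosInt, ← wInt_one_sub_sq_mul hβ, ← wInt_sub hβ (by fun_prop) (by fun_prop)]
    congr 1; ext z; ring
  rw [hf] at he
  have : β + 2 ≠ 0 := by linarith
  simp only [cosInt] at he ⊢
  have e : ξ * (-(ξ / (2 * (β + 2))) * wInt (β + 2) fun z => Real.cos (ξ * z))
      = - (ξ * (ξ * wInt (β + 2) fun z => Real.cos (ξ * z))) / (2 * (β + 2)) := by ring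
  rw [e, hd]
  field_simp
  linear_combination he

theorem abs_cosInt_le {β : ℝ} (hβ : 0 ≤ β) (ξ : ℝ) : |cosInt β ξ| ≤ 2 := by
  simpa [cosInt] using abs_wInt_le hβ (C := 1) fun z _ => Real.abs_cos_le_one (ξ * z)

theorem cosInt_zero_pos {β : ℝ} (hβ : 0 ≤ β) : 0 < cosInt β 0 :=
  wInt_pos hβ (by fun_prop) (fun z _ => by simp) (z₀ := 0) (by simp) (by simp)

/-- The Bessel function `J_{α + n + 1/2}`, up to a factor that does not depend on `n`. -/
noncomputable def besselJ (α : ℝ) (n : ℕ) (ξ : ℝ) : ℝ :=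
  ξ ^ (α + 1 / 2 + n) * cosInt (α + n) ξ / (2 ^ n * Real.Gamma (α + n + 1))

theorem besselSystem_besselJ {α : ℝ} (hα : 1 / 2 ≤ α) :
    BesselSystem (α + 1 / 2) (besselJ α) where
  pos := by linarith
  zero n := by
    have : (0 : ℝ) ≤ n := n.cast_nonneg
    rw [besselJ, Real.zero_rpow (by linarith), zero_mul, zero_div]
  small n := by
    have hn : (0 : ℝ) ≤ n := n.cast_nonneg
    have hG : 0 < 2 ^ n * Real.Gamma (α + n + 1) := by
      have := Real.Gamma_pos_of_pos (s := α + n + 1) (by linarith)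
      positivity
    refine ⟨2 / (2 ^ n * Real.Gamma (α + n + 1)), fun x hx => ?_⟩
    rw [besselJ, abs_div, abs_of_pos hG, abs_mul, abs_of_nonneg (Real.rpow_nonneg hx.1.le _),
      div_mul_eq_mul_div, mul_comm]
    have h1 : x ^ (α + 1 / 2 + n) ≤ x := by
      simpa using Real.rpow_le_rpow_of_exponent_ge hx.1 hx.2
        (show (1 : ℝ) ≤ α + 1 / 2 + n by linarith)
    have h2 := abs_cosInt_le (β := α + n) (by linarith) x
    have := hx.1.le
    gcongr
  deriv_self n x hx := by
    have hn : (0 : ℝ) ≤ n := n.cast_nonneg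
    have h1 := Real.hasDerivAt_rpow_const (x := x) (p := α + 1 / 2 + n) (Or.inl hx.ne')
    have h2 := hasDerivAt_cosInt (β := α + n) (by linarith) x
    have hG := (Real.Gamma_pos_of_pos (s := α + n + 1) (by linarith)).ne'
    have hG' := Real.Gamma_add_one (s := α + n + 1) (by linarith)
    have h3 := (h1.mul h2).div_const (2 ^ n * Real.Gamma (α + n + 1))
    refine h3.congr_deriv ?_
    simp only [besselJ]
    have ha : α + n + 1 ≠ 0 := by linarith
    push_cast
    rw [Real.rpow_sub_one hx.ne', show α + (n + 1 : ℝ) + 1 = α + n + 1 + 1 by ring, hG',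
      show α + 1 / 2 + (n + 1 : ℝ) = α + 1 / 2 + n + 1 by ring, Real.rpow_add_one hx.ne',
      show α + (n + 1 : ℝ) = α + n + 1 by ring]
    field_simp
    ring
  deriv_succ n x hx := by
    have hn : (0 : ℝ) ≤ n := n.cast_nonneg
    have h1 := Real.hasDerivAt_rpow_const (x := x) (p := α + 1 / 2 + (n + 1 : ℕ)) (Or.inl hx.ne')
    have h2 := hasDerivAt_cosInt (β := α + (n + 1 : ℕ)) (by push_cast; linarith) x
    have hr := cosInt_add_one (β := α + n) (by linarith) x
    have hG := (Real.Gamma_pos_of_pos (s := α + n + 1) (by linarith)).ne'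
    have hG' := Real.Gamma_add_one (s := α + n + 1) (by linarith)
    have h3 := (h1.mul h2).div_const (2 ^ (n + 1) * Real.Gamma (α + (n + 1 : ℕ) + 1))
    refine h3.congr_deriv ?_
    simp only [besselJ]
    have ha : α + n + 1 ≠ 0 := by linarith
    have ha' : α + n + 2 ≠ 0 := by linarith
    push_cast
    rw [Real.rpow_sub_one hx.ne', show α + (n + 1 : ℝ) + 1 = α + n + 2 by ring,
      show α + (n : ℝ) + 2 = α + n + 1 + 1 by ring, hG',
      show α + 1 / 2 + (n + 1 : ℝ) = α + 1 / 2 + n + 1 by ring, Real.rpow_add_one hx.ne',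
      show α + (n + 1 : ℝ) = α + n + 1 by ring, show α + (n : ℝ) + 1 + 1 = α + n + 2 by ring]
    field_simp
    field_simp at hr
    linear_combination 2 ^ n * hr

theorem integral_besselJ_sq_pos {α : ℝ} (hα : 1 / 2 ≤ α) :
    0 < ∫ x in Ioi 0, besselJ α 0 x * besselJ α 0 x / x := by
  have hs := besselSystem_besselJ hα
  have h0 : ∀ x ∈ Ioi (0 : ℝ), 0 ≤ besselJ α 0 x * besselJ α 0 x / x := fun x hx =>
    div_nonneg (mul_self_nonneg _) (mem_Ioi.1 hx).le
  rw [setIntegral_pos_iff_support_of_nonneg_ae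
    ((ae_restrict_iff' measurableSet_Ioi).2 (Eventually.of_forall h0)) (hs.integrableOn 0 0)]
  have hE : ∀ᶠ x in nhds (0 : ℝ), 0 < cosInt α x :=
    (hasDerivAt_cosInt (by linarith : 0 ≤ α) 0).continuousAt.eventually_const_lt
      (cosInt_zero_pos (by linarith))
  obtain ⟨ε, hε, hball⟩ := Metric.eventually_nhds_iff.1 hE
  have hsub : Ioo 0 ε ⊆ (Function.support fun x => besselJ α 0 x * besselJ α 0 x / x) ∩ Ioi 0 := by
    intro x hx
    refine ⟨?_, hx.1⟩
    have hJ : 0 < besselJ α 0 x := by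
      have h1 := hball (y := x) (by
        rw [Real.dist_eq, sub_zero, abs_of_pos hx.1]; exact hx.2)
      have h2 := Real.Gamma_pos_of_pos (s := α + (0 : ℕ) + 1) (by push_cast; linarith)
      have h3 := hx.1
      rw [besselJ]
      simp only [Nat.cast_zero, add_zero] at h2 ⊢
      positivity
    exact (div_pos (mul_pos hJ hJ) hx.1).ne'
  exact lt_of_lt_of_le (by simpa using hε) (measure_mono hsub)

/-- The coefficient of `((z - 1) / 2) ^ k` in the Jacobi polynomial `P_n^{(a,a)}`. -/
noncomputable def jacobiCoeff (a : ℝ) (n k : ℕ) : ℝ :=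
  Real.Gamma (a + n + 1) / (n.factorial * Real.Gamma (2 * a + n + 1)) *
    ((n.choose k : ℝ) * (Real.Gamma (2 * a + n + k + 1) / Real.Gamma (a + k + 1)))

theorem jacobiP_eq_sum (a : ℝ) (n : ℕ) (z : ℝ) :
    jacobiP a a n z = ∑ k ∈ Finset.range (n + 1), jacobiCoeff a n k * ((z - 1) / 2) ^ k := by
  rw [jacobiP, Finset.mul_sum]
  refine Finset.sum_congr rfl fun k _ => ?_
  rw [jacobiCoeff, two_mul]; ring

theorem hasDerivAt_jacobiP (a : ℝ) (n : ℕ) (z : ℝ) :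
    HasDerivAt (jacobiP a a n)
      (∑ k ∈ Finset.range (n + 1), jacobiCoeff a n k * (k * ((z - 1) / 2) ^ (k - 1) * (1 / 2)))
      z := by
  have h1 : HasDerivAt (fun z : ℝ => (z - 1) / 2) (1 / 2) z :=
    ((hasDerivAt_id z).sub_const 1).div_const 2
  have h2 : HasDerivAt
      (fun z => ∑ k ∈ Finset.range (n + 1), jacobiCoeff a n k * ((z - 1) / 2) ^ k)
      (∑ k ∈ Finset.range (n + 1), jacobiCoeff a n k * (k * ((z - 1) / 2) ^ (k - 1) * (1 / 2))) z :=
    HasDerivAt.fun_sum fun k _ => (h1.pow k).const_mul _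
  have h3 : jacobiP a a n
      = fun z => ∑ k ∈ Finset.range (n + 1), jacobiCoeff a n k * ((z - 1) / 2) ^ k :=
    funext (jacobiP_eq_sum a n)
  rwa [h3]

section coeff

variable {a : ℝ}

theorem jacobiCoeff_succ_mul (ha : 0 ≤ a) (n k : ℕ) :
    jacobiCoeff a (n + 1) (k + 1) * (k + 1) = (n + 2 * a + 2) * jacobiCoeff (a + 1) n k := by
  have hn : (0 : ℝ) ≤ n := n.cast_nonneg
  have hk : (0 : ℝ) ≤ k := k.cast_nonneg
  have hc : ((n + 1).choose (k + 1) : ℝ) * (k + 1) = (n + 1) * n.choose k := by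
    exact_mod_cast (Nat.add_one_mul_choose_eq n k).symm
  have g1 : Real.Gamma (2 * (a + 1) + n + 1)
      = (n + 2 * a + 2) * Real.Gamma (2 * a + (n + 1 : ℕ) + 1) := by
    rw [← show (2 * a + (n + 1 : ℕ) + 1) + 1 = 2 * (a + 1) + n + 1 by push_cast; ring,
      Real.Gamma_add_one (by push_cast; linarith)]
    push_cast; ring
  have e1 : a + 1 + n + 1 = a + (n + 1 : ℕ) + 1 := by push_cast; ring
  have e2 : 2 * (a + 1) + n + k + 1 = 2 * a + (n + 1 : ℕ) + (k + 1 : ℕ) + 1 := by push_cast; ring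
  have e3 : a + 1 + k + 1 = a + (k + 1 : ℕ) + 1 := by push_cast; ring
  rw [jacobiCoeff, jacobiCoeff, g1, e1, e2, e3, Nat.factorial_succ]
  have p1 := (Real.Gamma_pos_of_pos (s := 2 * a + (n + 1 : ℕ) + 1) (by push_cast; linarith)).ne'
  have p2 := (Real.Gamma_pos_of_pos (s := a + (k + 1 : ℕ) + 1) (by push_cast; linarith)).ne'
  have p3 : (n.factorial : ℝ) ≠ 0 := by positivity
  have p4 : (n : ℝ) + 1 ≠ 0 := by positivity
  have p5 : n + 2 * a + 2 ≠ 0 := by linarith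
  rw [Nat.cast_mul, Nat.cast_add_one n]
  rw [Nat.cast_add_one n] at p1
  field_simp
  linear_combination hc

theorem jacobiCoeff_raise_zero (ha : 0 ≤ a) (n : ℕ) :
    (n + 1) * jacobiCoeff a (n + 1) 0 = (a + 1) * jacobiCoeff (a + 1) n 0 := by
  have hn : (0 : ℝ) ≤ n := n.cast_nonneg
  have e1 : a + 1 + n + 1 = a + (n + 1 : ℕ) + 1 := by push_cast; ring
  have p0 := (Real.Gamma_pos_of_pos (s := a + 1) (by linarith)).ne'
  have p1 := (Real.Gamma_pos_of_pos (s := 2 * a + (n + 1 : ℕ) + 1) (by push_cast; linarith)).ne'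
  have p2 := (Real.Gamma_pos_of_pos (s := 2 * (a + 1) + n + 1) (by linarith)).ne'
  have p3 : (n.factorial : ℝ) ≠ 0 := by positivity
  have g : Real.Gamma (a + 1 + 1) = (a + 1) * Real.Gamma (a + 1) :=
    Real.Gamma_add_one (by linarith)
  have p4 : a + 1 ≠ 0 := by linarith
  simp only [jacobiCoeff, Nat.choose_zero_right, Nat.cast_zero, add_zero, Nat.cast_one, one_mul,
    e1, Nat.factorial_succ, Nat.cast_mul, g]
  rw [Nat.cast_add_one n] at p1 ⊢
  field_simp

theorem jacobiCoeff_raise_succ (ha : 0 ≤ a) (n k : ℕ) :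
    (n + 1) * jacobiCoeff a (n + 1) (k + 1)
      = (k + 1 + a + 1) * jacobiCoeff (a + 1) n (k + 1)
        + (k + 2 * (a + 1)) * jacobiCoeff (a + 1) n k := by
  have hn : (0 : ℝ) ≤ n := n.cast_nonneg
  have hk : (0 : ℝ) ≤ k := k.cast_nonneg
  have hc : ((n + 1).choose (k + 1) : ℝ) * (k + 1) = (n + 1) * n.choose k := by
    exact_mod_cast (Nat.add_one_mul_choose_eq n k).symm
  have hc' : ((n + 1).choose (k + 1) : ℝ) = n.choose k + n.choose (k + 1) := by
    exact_mod_cast Nat.choose_succ_succ n k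
  have g1 : Real.Gamma (2 * (a + 1) + n + 1)
      = (n + 2 * a + 2) * Real.Gamma (2 * a + (n + 1 : ℕ) + 1) := by
    rw [← show (2 * a + (n + 1 : ℕ) + 1) + 1 = 2 * (a + 1) + n + 1 by push_cast; ring,
      Real.Gamma_add_one (by push_cast; linarith)]
    push_cast; ring
  have g2 : Real.Gamma (2 * (a + 1) + n + (k + 1 : ℕ) + 1)
      = (n + k + 2 * a + 3) * Real.Gamma (2 * a + (n + 1 : ℕ) + (k + 1 : ℕ) + 1) := by
    rw [← show (2 * a + (n + 1 : ℕ) + (k + 1 : ℕ) + 1) + 1 = 2 * (a + 1) + n + (k + 1 : ℕ) + 1 by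
      push_cast; ring, Real.Gamma_add_one (by push_cast; linarith)]
    push_cast; ring
  have g3 : Real.Gamma (a + 1 + (k + 1 : ℕ) + 1)
      = (k + 1 + a + 1) * Real.Gamma (a + (k + 1 : ℕ) + 1) := by
    rw [← show (a + (k + 1 : ℕ) + 1) + 1 = a + 1 + (k + 1 : ℕ) + 1 by push_cast; ring,
      Real.Gamma_add_one (by push_cast; linarith)]
    push_cast; ring
  have e1 : a + 1 + n + 1 = a + (n + 1 : ℕ) + 1 := by push_cast; ring
  have e2 : 2 * (a + 1) + n + k + 1 = 2 * a + (n + 1 : ℕ) + (k + 1 : ℕ) + 1 := by push_cast; ring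
  have e3 : a + 1 + k + 1 = a + (k + 1 : ℕ) + 1 := by push_cast; ring
  rw [jacobiCoeff, jacobiCoeff, jacobiCoeff, g1, g2, g3, e1, e2, e3, Nat.factorial_succ]
  have p1 := (Real.Gamma_pos_of_pos (s := 2 * a + (n + 1 : ℕ) + 1) (by push_cast; linarith)).ne'
  have p2 := (Real.Gamma_pos_of_pos (s := a + (k + 1 : ℕ) + 1) (by push_cast; linarith)).ne'
  have p3 : (n.factorial : ℝ) ≠ 0 := by positivity
  have p4 : (n : ℝ) + 1 ≠ 0 := by positivity
  have p5 : n + 2 * a + 2 ≠ 0 := by linarith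
  have p6 : k + 1 + a + 1 ≠ 0 := by linarith
  rw [Nat.cast_mul, Nat.cast_add_one n]
  rw [Nat.cast_add_one n] at p1
  have key : ((n + 1).choose (k + 1) : ℝ) * (n + 2 * a + 2)
      = n.choose (k + 1) * (n + k + 2 * a + 3) + (k + 2 * (a + 1)) * n.choose k := by
    linear_combination (n + k + 2 * a + 3) * hc' - hc
  field_simp
  linear_combination key

end coeff

theorem jacobiP_zero {a : ℝ} (ha : 0 ≤ a) (z : ℝ) : jacobiP a a 0 z = 1 := by
  have p1 := (Real.Gamma_pos_of_pos (s := a + 1) (by linarith)).ne'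
  have p2 := (Real.Gamma_pos_of_pos (s := 2 * a + 1) (by linarith)).ne'
  rw [jacobiP_eq_sum]
  simp only [zero_add, Finset.sum_range_one, jacobiCoeff, Nat.cast_zero, add_zero, pow_zero,
    Nat.factorial_zero, Nat.choose_self, Nat.cast_one]
  field_simp

theorem hasDerivAt_jacobiP_succ {a : ℝ} (ha : 0 ≤ a) (n : ℕ) (z : ℝ) :
    HasDerivAt (jacobiP a a (n + 1)) ((n + 2 * a + 2) / 2 * jacobiP (a + 1) (a + 1) n z) z := by
  convert hasDerivAt_jacobiP a (n + 1) z using 1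
  rw [Finset.sum_range_succ', jacobiP_eq_sum, Finset.mul_sum]
  simp only [Nat.cast_zero, zero_mul, mul_zero, add_zero, Nat.add_sub_cancel]
  refine Finset.sum_congr rfl fun k _ => ?_
  have := jacobiCoeff_succ_mul ha n k
  push_cast
  linear_combination (-(((z - 1) / 2) ^ k) / 2) * this

theorem continuous_jacobiP (a : ℝ) (n : ℕ) : Continuous (jacobiP a a n) :=
  continuous_iff_continuousAt.2 fun z => (hasDerivAt_jacobiP a n z).continuousAt

/-- The raising relation between Jacobi polynomials of neighbouring weights. -/
theorem jacobiP_raise {a : ℝ} (ha : 0 ≤ a) (n : ℕ) (z : ℝ) :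
    2 * (a + 1) * z * jacobiP (a + 1) (a + 1) n z
      - (1 - z ^ 2) * deriv (jacobiP (a + 1) (a + 1) n) z
      = 2 * (n + 1) * jacobiP a a (n + 1) z := by
  rw [(hasDerivAt_jacobiP (a + 1) n z).deriv]
  obtain ⟨y, rfl⟩ : ∃ y, z = 2 * y + 1 := ⟨(z - 1) / 2, by ring⟩
  have hy : (2 * y + 1 - 1) / 2 = y := by ring
  rw [jacobiP_eq_sum, jacobiP_eq_sum]
  simp only [hy]
  have t1 : ∀ k : ℕ, (1 - (2 * y + 1) ^ 2) * (jacobiCoeff (a + 1) n k * (k * y ^ (k - 1) * (1 / 2)))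
      = -2 * (y + 1) * (jacobiCoeff (a + 1) n k * (k * y ^ k)) := by
    intro k
    rcases k with _ | k
    · simp
    · simp only [Nat.add_sub_cancel]; ring
  rw [Finset.mul_sum, Finset.mul_sum, ← Finset.sum_sub_distrib, Finset.mul_sum]
  have hsplit : ∑ k ∈ Finset.range (n + 1), (2 * (a + 1) * (2 * y + 1) *
        (jacobiCoeff (a + 1) n k * y ^ k) - (1 - (2 * y + 1) ^ 2) *
        (jacobiCoeff (a + 1) n k * (k * y ^ (k - 1) * (1 / 2))))
      = ∑ k ∈ Finset.range (n + 1 + 1), 2 * ((k + a + 1) * jacobiCoeff (a + 1) n k) * y ^ k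
        + ∑ k ∈ Finset.range (n + 1), 2 * ((k + 2 * (a + 1)) * jacobiCoeff (a + 1) n k)
          * y ^ (k + 1) := by
    rw [Finset.sum_range_succ _ (n + 1)]
    have : jacobiCoeff (a + 1) n (n + 1) = 0 := by simp [jacobiCoeff]
    rw [this, mul_zero, mul_zero, zero_mul, add_zero, ← Finset.sum_add_distrib]
    refine Finset.sum_congr rfl fun k _ => ?_
    rw [t1]; ring
  rw [hsplit, Finset.sum_range_succ' _ (n + 1), Finset.sum_range_succ' _ (n + 1), add_right_comm,
    ← Finset.sum_add_distrib]
  congr 1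
  · refine Finset.sum_congr rfl fun k _ => ?_
    have := jacobiCoeff_raise_succ ha n k
    push_cast
    linear_combination (-2 * y ^ (k + 1)) * this
  · have := jacobiCoeff_raise_zero ha n
    push_cast
    linear_combination -2 * this

theorem wInt_mul_const_mul {β : ℝ} {F G : ℝ → ℝ} (c : ℝ) :
    wInt β (fun z => F z * (c * G z)) = c * wInt β (fun z => F z * G z) := by
  rw [← wInt_const_mul]
  exact congrArg _ (funext fun z => mul_left_comm _ _ _)

section byParts

variable {a : ℝ}

theorem wInt_jacobiP_succ_mul (ha : 0 ≤ a) (n : ℕ) {F F' : ℝ → ℝ}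
    (hF : ∀ z, HasDerivAt F (F' z) z) (hF' : Continuous F') :
    wInt a (fun z => jacobiP a a (n + 1) z * F z)
      = 1 / (2 * (n + 1)) * wInt (a + 1) (fun z => jacobiP (a + 1) (a + 1) n z * F' z) := by
  have hFc : Continuous F := continuous_iff_continuousAt.2 fun z => (hF z).continuousAt
  have hP := continuous_jacobiP (a + 1) n
  have hd : ∀ z, HasDerivAt (jacobiP (a + 1) (a + 1) n) (deriv (jacobiP (a + 1) (a + 1) n) z) z :=
    fun z => (hasDerivAt_jacobiP (a + 1) n z).differentiableAt.hasDerivAt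
  have hdc : Continuous (deriv (jacobiP (a + 1) (a + 1) n)) := by
    have : deriv (jacobiP (a + 1) (a + 1) n) = _ :=
      funext fun z => (hasDerivAt_jacobiP (a + 1) n z).deriv
    rw [this]; fun_prop
  have h1 := wInt_deriv (F := fun z => jacobiP (a + 1) (a + 1) n z * F z) ha
    (fun z => (hd z).mul (hF z)) ((hdc.mul hFc).add (hP.mul hF'))
  rw [wInt_add (F := fun z => deriv (jacobiP (a + 1) (a + 1) n) z * F z)
    (G := fun z => jacobiP (a + 1) (a + 1) n z * F' z) (by linarith) (hdc.mul hFc) (hP.mul hF'),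
    ← wInt_one_sub_sq_mul ha,
    ← wInt_const_mul, ← eq_sub_iff_add_eq', ← wInt_sub ha (by fun_prop) (by fun_prop)] at h1
  rw [h1, ← wInt_const_mul]
  refine congrArg _ (funext fun z => ?_)
  have h3 := jacobiP_raise ha n z
  have h4 : (n : ℝ) + 1 ≠ 0 := by positivity
  field_simp
  linear_combination (-F z) * h3

theorem wInt_jacobiP_mul_jacobiP (ha : 0 ≤ a) {i j : ℕ} (hij : i ≠ j) :
    wInt a (fun z => jacobiP a a i z * jacobiP a a j z) = 0 := by
  wlog h : j < i generalizing i j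
  · simpa only [mul_comm] using this hij.symm (by omega)
  obtain ⟨i, rfl⟩ : ∃ i', i = i' + 1 := ⟨i - 1, by omega⟩
  clear hij
  induction j generalizing i a with
  | zero =>
    rw [wInt_jacobiP_succ_mul ha i (F' := fun _ => 0) (fun z => ?_) continuous_const]
    · simp [wInt]
    · have : jacobiP a a 0 = fun _ => 1 := funext (jacobiP_zero ha)
      rw [this]; exact hasDerivAt_const _ _
  | succ j ih =>
    obtain ⟨i, rfl⟩ : ∃ i', i = i' + 1 := ⟨i - 1, by omega⟩
    rw [wInt_jacobiP_succ_mul ha (i + 1) (hasDerivAt_jacobiP_succ ha j)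
      (continuous_const.mul (continuous_jacobiP _ _))]
    rw [wInt_mul_const_mul, ih (by linarith) _ (by omega), mul_zero, mul_zero]

theorem wInt_jacobiP_sq_succ (ha : 0 ≤ a) (k : ℕ) :
    wInt a (fun z => jacobiP a a (k + 1) z * jacobiP a a (k + 1) z)
      = (k + 2 * a + 2) / (4 * (k + 1)) *
        wInt (a + 1) (fun z => jacobiP (a + 1) (a + 1) k z * jacobiP (a + 1) (a + 1) k z) := by
  rw [wInt_jacobiP_succ_mul ha k (hasDerivAt_jacobiP_succ ha k)
      (continuous_const.mul (continuous_jacobiP _ _))]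
  rw [wInt_mul_const_mul]
  have h4 : (k : ℝ) + 1 ≠ 0 := by positivity
  field_simp
  norm_num [mul_comm]

end byParts

section norm

variable {l : ℝ}

theorem jacobiNormSq_pos (hl : -1 ≤ l) (k : ℕ) : 0 < jacobiNormSq l k := by
  have hk : (0 : ℝ) ≤ k := k.cast_nonneg
  have h1 := Real.Gamma_pos_of_pos (s := k + l + 2) (by linarith)
  have h2 := Real.Gamma_pos_of_pos (s := k + 2 * l + 3) (by linarith)
  have h3 : 0 < 2 * (k : ℝ) + 2 * l + 3 := by linarith
  have h4 : (0 : ℝ) < k.factorial := by positivity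
  rw [jacobiNormSq]; positivity

theorem jacobiNormSq_succ (hl : -1 ≤ l) (k : ℕ) :
    jacobiNormSq l (k + 1)
      = (k + 2 * (l + 1) + 2) / (4 * (k + 1)) * jacobiNormSq (l + 1) k := by
  have hk : (0 : ℝ) ≤ k := k.cast_nonneg
  have h2 := (Real.Gamma_pos_of_pos (s := k + 2 * l + 4) (by linarith)).ne'
  have g : Real.Gamma (k + 2 * (l + 1) + 3) = (k + 2 * l + 4) * Real.Gamma (k + 2 * l + 4) := by
    rw [← Real.Gamma_add_one (by linarith)]; congr 1; ring
  have r : (2 : ℝ) ^ (2 * (l + 1) + 3) = 4 * 2 ^ (2 * l + 3) := by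
    rw [show 2 * (l + 1) + 3 = 2 * l + 3 + (2 : ℕ) by push_cast; ring,
      Real.rpow_add_natCast (by norm_num)]; norm_num; ring
  rw [jacobiNormSq, jacobiNormSq, g, r, Nat.factorial_succ]
  push_cast
  rw [show (k + 1 + 2 * l + 3 : ℝ) = k + 2 * l + 4 by ring,
    show (k + 1 + l + 2 : ℝ) = k + (l + 1) + 2 by ring]
  have h3 : (k : ℝ) + 2 * l + 4 ≠ 0 := by linarith
  have h4 : 2 * (k : ℝ) + 2 * l + 5 ≠ 0 := by linarith
  rw [show 2 * (k + 1 : ℝ) + 2 * l + 3 = 2 * k + 2 * l + 5 by ring,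
    show 2 * (k : ℝ) + 2 * (l + 1) + 3 = 2 * k + 2 * l + 5 by ring]
  field_simp
  ring

theorem jacobiNormSq_zero_succ (hl : -1 ≤ l) :
    (2 * l + 5) * jacobiNormSq (l + 1) 0 = (2 * l + 4) * jacobiNormSq l 0 := by
  have h1 := (Real.Gamma_pos_of_pos (s := l + 2) (by linarith)).ne'
  have h2 := (Real.Gamma_pos_of_pos (s := 2 * l + 3) (by linarith)).ne'
  have g : Real.Gamma (2 * (l + 1) + 3) = (2 * l + 4) * ((2 * l + 3) * Real.Gamma (2 * l + 3)) := by
    rw [← Real.Gamma_add_one (by linarith), ← show 2 * l + 3 + 1 = 2 * l + 4 by ring,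
      ← Real.Gamma_add_one (by linarith)]; congr 1; ring
  have g' : Real.Gamma (l + 1 + 2) = (l + 2) * Real.Gamma (l + 2) := by
    rw [← Real.Gamma_add_one (by linarith)]; congr 1; ring
  have r : (2 : ℝ) ^ (2 * (l + 1) + 3) = 4 * 2 ^ (2 * l + 3) := by
    rw [show 2 * (l + 1) + 3 = 2 * l + 3 + (2 : ℕ) by push_cast; ring,
      Real.rpow_add_natCast (by norm_num)]; norm_num; ring
  simp only [jacobiNormSq, Nat.cast_zero, mul_zero, zero_add, g, g', r, Nat.factorial_zero,
    Nat.cast_one, one_mul]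
  have h3 : 2 * l + 3 ≠ 0 := by linarith
  have h4 : 2 * l + 4 ≠ 0 := by linarith
  have h5 : 2 * l + 5 ≠ 0 := by linarith
  have h6 : 2 * (l + 1) + 3 = 2 * l + 5 := by ring
  have h7 : 2 * l + 4 = 2 * (l + 2) := by ring
  have h8 : l + 2 ≠ 0 := by linarith
  rw [h6, h7]
  field_simp
  norm_num

/-- `jacobiNormSq` is, up to a factor independent of the degree, the weighted norm. -/
theorem wInt_jacobiP_sq (hl : -1 ≤ l) (k : ℕ) :
    wInt (l + 1) (fun z => jacobiP (l + 1) (l + 1) k z * jacobiP (l + 1) (l + 1) k z)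
      = cosInt (l + 1) 0 / jacobiNormSq l 0 * jacobiNormSq l k := by
  induction k generalizing l with
  | zero =>
    rw [div_mul_cancel₀ _ (jacobiNormSq_pos hl 0).ne']
    simp [jacobiP_zero (show 0 ≤ l + 1 by linarith), cosInt]
  | succ k ih =>
    rw [wInt_jacobiP_sq_succ (by linarith), ih (by linarith), jacobiNormSq_succ hl]
    have h1 := cosInt_add_one (β := l + 1) (by linarith) 0
    have h2 := jacobiNormSq_zero_succ hl
    have h3 := (jacobiNormSq_pos hl 0).ne'
    have h4 := (jacobiNormSq_pos (l := l + 1) (by linarith) 0).ne'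
    have h5 : 2 * l + 5 ≠ 0 := by linarith
    have h6 : cosInt (l + 1 + 1) 0 / jacobiNormSq (l + 1) 0
        = cosInt (l + 1) 0 / jacobiNormSq l 0 := by
      rw [div_eq_div_iff h4 h3]
      refine mul_left_cancel₀ h5 ?_
      linear_combination jacobiNormSq l 0 * h1 - cosInt (l + 1) 0 * h2
    rw [h6]; ring

end norm

theorem wInt_eq_zero_of_odd {β : ℝ} {F : ℝ → ℝ} (h : ∀ z, F (-z) = -F z) : wInt β F = 0 := by
  have := intervalIntegral.integral_comp_neg (a := -1) (b := 1)
    (fun z : ℝ => (1 - z ^ 2) ^ β * F z)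
  simp only [neg_neg, neg_sq, h, mul_neg, intervalIntegral.integral_neg] at this
  rw [wInt]; linarith

theorem wInt_cos_add {β : ℝ} (hβ : 0 ≤ β) (ξ θ : ℝ) :
    wInt β (fun z => Real.cos (ξ * z + θ)) = Real.cos θ * cosInt β ξ := by
  simp only [Real.cos_add]
  rw [wInt_sub hβ (by fun_prop) (by fun_prop)]
  simp only [mul_comm _ (Real.cos θ), mul_comm _ (Real.sin θ)]
  rw [wInt_const_mul, wInt_const_mul, wInt_eq_zero_of_odd (F := fun z => Real.sin (ξ * z))
    (fun z => by simp), cosInt]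
  ring

theorem wInt_jacobiP_mul_cos {a : ℝ} (ha : 0 ≤ a) (k : ℕ) (ξ θ : ℝ) :
    wInt a (fun z => jacobiP a a k z * Real.cos (ξ * z + θ))
      = (ξ / 2) ^ k / k.factorial * Real.cos (θ + k * (Real.pi / 2)) * cosInt (a + k) ξ := by
  induction k generalizing a θ with
  | zero => simp [jacobiP_zero ha, wInt_cos_add ha]
  | succ k ih =>
    rw [wInt_jacobiP_succ_mul ha k (F' := fun z => ξ * Real.cos (ξ * z + (θ + Real.pi / 2)))
      (fun z => ?_) (by fun_prop)]
    · rw [wInt_mul_const_mul, ih (by linarith), Nat.factorial_succ]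
      have h4 : (k : ℝ) + 1 ≠ 0 := by positivity
      push_cast
      rw [show a + 1 + (k : ℝ) = a + (k + 1) by ring,
        show θ + Real.pi / 2 + k * (Real.pi / 2) = θ + (k + 1) * (Real.pi / 2) by ring]
      field_simp
      ring
    · have : HasDerivAt (fun z : ℝ => ξ * z + θ) ξ z := by
        simpa using ((hasDerivAt_id z).const_mul ξ).add_const θ
      convert this.cos using 1
      rw [← add_assoc, Real.cos_add_pi_div_two]; ring

/-- The Jacobi polynomial `P_n^{(a,a)}` as an element of `ℝ[X]`. -/
noncomputable def jacobiPoly (a : ℝ) (n : ℕ) : Polynomial ℝ :=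
  (∑ k ∈ Finset.range (n + 1), Polynomial.monomial k (jacobiCoeff a n k)).comp
    (Polynomial.C (1 / 2) * Polynomial.X - Polynomial.C (1 / 2))

theorem eval_jacobiPoly (a : ℝ) (n : ℕ) (z : ℝ) : (jacobiPoly a n).eval z = jacobiP a a n z := by
  rw [jacobiP_eq_sum, jacobiPoly, Polynomial.eval_comp, Polynomial.eval_finsetSum]
  refine Finset.sum_congr rfl fun k _ => ?_
  rw [Polynomial.eval_monomial]
  simp only [Polynomial.eval_sub, Polynomial.eval_mul, Polynomial.eval_C, Polynomial.eval_X]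
  rw [show (1 / 2 : ℝ) * z - 1 / 2 = (z - 1) / 2 by ring]

theorem degree_jacobiPoly {a : ℝ} (ha : 0 ≤ a) (n : ℕ) : (jacobiPoly a n).degree = n := by
  have hc : jacobiCoeff a n n ≠ 0 := by
    have hn : (0 : ℝ) ≤ n := n.cast_nonneg
    have p1 := (Real.Gamma_pos_of_pos (s := a + n + 1) (by linarith)).ne'
    have p2 := (Real.Gamma_pos_of_pos (s := 2 * a + n + 1) (by linarith)).ne'
    have p3 := (Real.Gamma_pos_of_pos (s := 2 * a + n + n + 1) (by linarith)).ne'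
    have p4 : (n.factorial : ℝ) ≠ 0 := by positivity
    rw [jacobiCoeff, Nat.choose_self]
    simp [p1, p2, p3, p4]
  have h1 : (∑ k ∈ Finset.range (n + 1),
      Polynomial.monomial k (jacobiCoeff a n k)).natDegree = n := by
    refine Polynomial.natDegree_eq_of_le_of_coeff_ne_zero
      (Polynomial.natDegree_sum_le_of_forall_le _ _ fun k hk => ?_) ?_
    · exact (Polynomial.natDegree_monomial_le _).trans (by simpa [Nat.lt_succ_iff] using hk)
    · simpa [Polynomial.finsetSum_coeff, Polynomial.coeff_monomial] using hc
  have h2 : (jacobiPoly a n).natDegree = n := by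
    rw [jacobiPoly, Polynomial.natDegree_comp, h1, Polynomial.natDegree_sub_C,
      Polynomial.natDegree_C_mul_X _ (by norm_num), mul_one]
  rcases n with _ | n
  · have : jacobiPoly a 0 ≠ 0 := fun h => by
      have := eval_jacobiPoly a 0 0
      rw [h, jacobiP_zero ha] at this
      simp at this
    rw [Polynomial.degree_eq_natDegree this, h2]
  · exact (Polynomial.degree_eq_iff_natDegree_eq_of_pos n.succ_pos).2 h2

theorem span_jacobiPoly {a : ℝ} (ha : 0 ≤ a) :
    Submodule.span ℝ (range (jacobiPoly a)) = ⊤ := by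
  let S : Polynomial.Sequence ℝ := ⟨jacobiPoly a, degree_jacobiPoly ha⟩
  exact S.span fun i => isUnit_iff_ne_zero.2 (Polynomial.leadingCoeff_ne_zero.2 fun h => by
    have := degree_jacobiPoly ha i
    rw [show jacobiPoly a i = 0 from h] at this
    simp at this)

/-- The cosine transform of `(1 - z²)^α F(z)` on `[-1, 1]`. -/
noncomputable def cosT (α : ℝ) (F : ℝ → ℝ) (ξ : ℝ) : ℝ := wInt α fun z => F z * Real.cos (ξ * z)

theorem cosT_add {α : ℝ} (hα : 0 ≤ α) {F G : ℝ → ℝ} (hF : Continuous F) (hG : Continuous G)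
    (ξ : ℝ) : cosT α (fun z => F z + G z) ξ = cosT α F ξ + cosT α G ξ := by
  simp only [cosT, add_mul]
  exact wInt_add hα (by fun_prop) (by fun_prop)

theorem cosT_const_mul {α : ℝ} (c : ℝ) {F : ℝ → ℝ} (ξ : ℝ) :
    cosT α (fun z => c * F z) ξ = c * cosT α F ξ := by
  simp only [cosT, mul_assoc]
  exact wInt_const_mul c

theorem continuous_cosT {α : ℝ} (hα : 0 ≤ α) {F : ℝ → ℝ} (hF : Continuous F) :
    Continuous (cosT α F) := by
  have h := continuous_weight hα
  exact intervalIntegral.continuous_parametric_intervalIntegral_of_continuous' (by fun_prop) _ _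

theorem cosT_jacobiP {α : ℝ} (hα : 1 / 2 ≤ α) (j : ℕ) {ξ : ℝ} (hξ : 0 < ξ) :
    cosT α (jacobiP α α j) ξ * ξ ^ (α - 1 / 2)
      = Real.cos (j * (Real.pi / 2)) * Real.Gamma (α + j + 1) / j.factorial
        * (besselJ α j ξ / ξ) := by
  have hj : (0 : ℝ) ≤ j := j.cast_nonneg
  have h := wInt_jacobiP_mul_cos (show 0 ≤ α by linarith) j ξ 0
  simp only [add_zero, zero_add] at h
  have hG := (Real.Gamma_pos_of_pos (s := α + j + 1) (by linarith)).ne'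
  rw [cosT, h, besselJ, show α + 1 / 2 + j = (α - 1 / 2) + 1 + j by ring,
    Real.rpow_add_natCast hξ.ne', Real.rpow_add_one hξ.ne', div_pow]
  have : (j.factorial : ℝ) ≠ 0 := by positivity
  field_simp

/-- The pairing of the cosine transform of `(1 - z²)^α F(z)` with `ξ^{α-1/2} J_{α+k+1/2}(ξ)`
is the pairing of `F` with the Jacobi polynomial of degree `k`, up to the factor `Λ`. -/
def BesselPairing (α : ℝ) (k : ℕ) (Λ : ℝ) (F : ℝ → ℝ) : Prop :=
  IntegrableOn (fun ξ => cosT α F ξ * (ξ ^ (α - 1 / 2) * besselJ α k ξ)) (Ioi 0) ∧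
    ∫ ξ in Ioi 0, cosT α F ξ * (ξ ^ (α - 1 / 2) * besselJ α k ξ)
      = Λ * wInt α (fun z => F z * jacobiP α α k z)

section pairing

variable {α Λ : ℝ} {k : ℕ} {F G : ℝ → ℝ}

theorem BesselPairing.add (hα : 0 ≤ α) (hFc : Continuous F) (hGc : Continuous G)
    (hF : BesselPairing α k Λ F) (hG : BesselPairing α k Λ G) :
    BesselPairing α k Λ (fun z => F z + G z) := by
  have hP := continuous_jacobiP α k
  simp only [BesselPairing, cosT_add hα hFc hGc, add_mul]
  refine ⟨hF.1.add hG.1, ?_⟩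
  rw [integral_add hF.1 hG.1, hF.2, hG.2, wInt_add hα (by fun_prop) (by fun_prop), mul_add]

theorem BesselPairing.const_mul (c : ℝ) (hF : BesselPairing α k Λ F) :
    BesselPairing α k Λ (fun z => c * F z) := by
  simp only [BesselPairing, cosT_const_mul, mul_assoc]
  refine ⟨hF.1.const_mul c, ?_⟩
  rw [integral_const_mul, hF.2, wInt_const_mul]; ring

/-- The constant relating the two pairings of `BesselPairing`. -/
noncomputable def pairingConst (α : ℝ) (k : ℕ) : ℝ :=
  Real.cos (k * (Real.pi / 2)) * Real.Gamma (α + k + 1) / k.factorial *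
    (∫ x in Ioi 0, besselJ α k x * besselJ α k x / x) /
      wInt α (fun z => jacobiP α α k z * jacobiP α α k z)

theorem wInt_jacobiP_sq_pos (hα : 0 ≤ α) (k : ℕ) :
    0 < wInt α (fun z => jacobiP α α k z * jacobiP α α k z) := by
  have := wInt_jacobiP_sq (l := α - 1) (by linarith) k
  rw [sub_add_cancel] at this
  rw [this]
  exact mul_pos (div_pos (cosInt_zero_pos hα) (jacobiNormSq_pos (by linarith) 0))
    (jacobiNormSq_pos (by linarith) k)

theorem besselPairing_jacobiP (hα : 1 / 2 ≤ α) (hk : Even k) (j : ℕ) :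
    BesselPairing α k (pairingConst α k) (jacobiP α α j) := by
  have hs := besselSystem_besselJ hα
  have e : EqOn (fun ξ => cosT α (jacobiP α α j) ξ * (ξ ^ (α - 1 / 2) * besselJ α k ξ))
      (fun ξ => Real.cos (j * (Real.pi / 2)) * Real.Gamma (α + j + 1) / j.factorial
        * (besselJ α j ξ * besselJ α k ξ / ξ)) (Ioi 0) := fun ξ hξ => by
    have := cosT_jacobiP hα j hξ
    simp only
    rw [← mul_assoc, this]; ring
  refine ⟨IntegrableOn.congr_fun (Integrable.const_mul (hs.integrableOn j k) _) e.symm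
    measurableSet_Ioi, ?_⟩
  rw [setIntegral_congr_fun measurableSet_Ioi e, integral_const_mul]
  by_cases hjk : j = k
  · subst hjk
    rw [pairingConst, div_mul_cancel₀ _ (wInt_jacobiP_sq_pos (by linarith) j).ne']
  · rw [wInt_jacobiP_mul_jacobiP (by linarith) hjk, mul_zero]
    rcases Nat.even_or_odd j with hj | hj
    · rw [hs.integral_even_shift_eq_zero hj hk hjk, mul_zero]
    · obtain ⟨m, rfl⟩ := hj
      have : Real.cos (((2 * m + 1 : ℕ) : ℝ) * (Real.pi / 2)) = 0 := by
        rw [Real.cos_eq_zero_iff]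
        exact ⟨m, by push_cast; ring⟩
      rw [this]; simp

theorem besselPairing_polynomial (hα : 1 / 2 ≤ α) (hk : Even k) (p : Polynomial ℝ) :
    BesselPairing α k (pairingConst α k) (fun z => p.eval z) := by
  have hp : p ∈ Submodule.span ℝ (range (jacobiPoly α)) := by
    rw [span_jacobiPoly (by linarith)]; trivial
  induction hp using Submodule.span_induction with
  | mem q hq =>
    obtain ⟨j, rfl⟩ := hq
    simp only [eval_jacobiPoly]
    exact besselPairing_jacobiP hα hk j
  | zero =>
    simpa using (besselPairing_jacobiP hα hk 0).const_mul 0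
  | add p q _ _ hp hq =>
    simpa using hp.add (by linarith) p.continuous q.continuous hq
  | smul c p _ hp => simpa using hp.const_mul c

end pairing

/-- `|r^{(j)}| ≤ ε` on `[-1, 1]` for all `j ≤ M`. -/
def DerivBound (M : ℕ) (ε : ℝ) (r : ℝ → ℝ) : Prop :=
  ∀ j ≤ M, ∀ z ∈ Icc (-1 : ℝ) 1, |iteratedDeriv j r z| ≤ ε

theorem DerivBound.abs_le {M : ℕ} {ε : ℝ} {r : ℝ → ℝ} (h : DerivBound M ε r) {z : ℝ}
    (hz : z ∈ Icc (-1 : ℝ) 1) : |r z| ≤ ε := by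
  simpa using h 0 (Nat.zero_le _) z hz

theorem DerivBound.nonneg {M : ℕ} {ε : ℝ} {r : ℝ → ℝ} (h : DerivBound M ε r) : 0 ≤ ε :=
  (abs_nonneg _).trans (h.abs_le (z := 0) (by simp))

theorem DerivBound.deriv {M : ℕ} {ε : ℝ} {r : ℝ → ℝ} (h : DerivBound (M + 1) ε r) :
    DerivBound M ε (deriv r) := fun j hj z hz => by
  rw [← iteratedDeriv_succ']
  exact h (j + 1) (by omega) z hz

theorem DerivBound.mono {M N : ℕ} {ε : ℝ} {r : ℝ → ℝ} (h : DerivBound M ε r) (hN : N ≤ M) :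
    DerivBound N ε r := fun j hj => h j (hj.trans hN)

theorem exists_abs_le_of_continuous {F : ℝ → ℝ} (hF : Continuous F) :
    ∃ B, 0 ≤ B ∧ ∀ z ∈ Icc (-1 : ℝ) 1, |F z| ≤ B := by
  obtain ⟨B, hB⟩ := isCompact_Icc.exists_bound_of_continuousOn hF.continuousOn
  exact ⟨B, (norm_nonneg _).trans (hB 0 (by norm_num)), hB⟩

open scoped ContDiff in
theorem exists_abs_pow_mul_wInt_le (M : ℕ) (p : Polynomial ℝ) {β : ℝ} (hβ : 0 ≤ β) :
    ∃ C, 0 ≤ C ∧ ∀ (r : ℝ → ℝ) (ε : ℝ), ContDiff ℝ ∞ r → DerivBound M ε r → ∀ ξ θ : ℝ,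
      |ξ ^ M * wInt (β + M) (fun z => p.eval z * r z * Real.cos (ξ * z + θ))| ≤ C * ε := by
  induction M generalizing p with
  | zero =>
    obtain ⟨B, hB0, hB⟩ := exists_abs_le_of_continuous p.continuous
    refine ⟨2 * B, by positivity, fun r ε _ hε ξ θ => ?_⟩
    have := abs_wInt_le hβ (F := fun z => p.eval z * r z * Real.cos (ξ * z + θ)) (C := B * ε)
      (fun z hz => by
        rw [abs_mul, abs_mul]
        have h1 := hB z hz
        have h2 := hε.abs_le hz
        have h3 := Real.abs_cos_le_one (ξ * z + θ)
        have h4 := hε.nonneg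
        calc _ ≤ B * ε * 1 := by gcongr
          _ = _ := mul_one _)
    simp only [pow_zero, one_mul, Nat.cast_zero, add_zero]
    linarith
  | succ M ih =>
    obtain ⟨C₁, hC₁, h₁⟩ := ih (Polynomial.C (2 * (β + M + 1)) * Polynomial.X * p
      - (1 - Polynomial.X ^ 2) * Polynomial.derivative p)
    obtain ⟨C₂, hC₂, h₂⟩ := ih ((1 - Polynomial.X ^ 2) * p)
    refine ⟨C₁ + C₂, by positivity, fun r ε hr hε ξ θ => ?_⟩
    have hM : (0 : ℝ) ≤ M := M.cast_nonneg
    have hβM : 0 ≤ β + M := by linarith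
    obtain ⟨hrd, hr'⟩ := contDiff_infty_iff_deriv.1 hr
    have e1 := h₁ r ε hr (hε.mono (Nat.le_succ _)) ξ (θ - Real.pi / 2)
    have e2 := h₂ (deriv r) ε hr' hε.deriv ξ (θ - Real.pi / 2)
    have hsin : ∀ z, Real.cos (ξ * z + (θ - Real.pi / 2)) = Real.sin (ξ * z + θ) := fun z => by
      rw [← add_sub_assoc, Real.cos_sub_pi_div_two]
    simp only [hsin] at e1 e2
    have c0 := hr.continuous
    have c1 := hr'.continuous
    have c2 := p.continuous
    have c3 := (Polynomial.derivative p).continuous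
    have hbp := wInt_deriv (β := β + M)
      (F := fun z => p.eval z * r z * Real.sin (ξ * z + θ))
      (F' := fun z => ((Polynomial.derivative p).eval z * r z + p.eval z * deriv r z)
        * Real.sin (ξ * z + θ) + ξ * (p.eval z * r z * Real.cos (ξ * z + θ))) hβM
      (fun z => by
        have : HasDerivAt (fun z : ℝ => ξ * z + θ) ξ z := by
          simpa using ((hasDerivAt_id z).const_mul ξ).add_const θ
        refine (((p.hasDerivAt z).mul (hrd z).hasDerivAt).mul this.sin).congr_deriv ?_
        simp only [Pi.mul_apply]
        ring) (by fun_prop)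
    rw [wInt_add (by linarith) (by fun_prop) (by fun_prop), wInt_const_mul,
      ← wInt_one_sub_sq_mul hβM, ← wInt_const_mul (2 * (β + M + 1)), ← eq_sub_iff_add_eq',
      ← wInt_sub hβM (by fun_prop) (by fun_prop)] at hbp
    have key : ξ * wInt (β + M + 1) (fun z => p.eval z * r z * Real.cos (ξ * z + θ))
        = wInt (β + M) (fun z => (Polynomial.C (2 * (β + M + 1)) * Polynomial.X * p
              - (1 - Polynomial.X ^ 2) * Polynomial.derivative p).eval z * r z
              * Real.sin (ξ * z + θ))
          - wInt (β + M) (fun z => ((1 - Polynomial.X ^ 2) * p).eval z * deriv r z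
              * Real.sin (ξ * z + θ)) := by
      rw [hbp, ← wInt_sub hβM (by fun_prop) (by fun_prop)]
      refine congrArg _ (funext fun z => ?_)
      simp only [Polynomial.eval_sub, Polynomial.eval_mul, Polynomial.eval_C, Polynomial.eval_X,
        Polynomial.eval_one, Polynomial.eval_pow]
      ring
    push_cast
    rw [← add_assoc, pow_succ, mul_assoc, key, mul_sub]
    refine (abs_sub _ _).trans ?_
    linarith

theorem exists_derivative_eq (p : Polynomial ℝ) :
    ∃ q : Polynomial ℝ, Polynomial.derivative q = p := by
  induction p using Polynomial.induction_on' with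
  | add p q hp hq =>
    obtain ⟨p', rfl⟩ := hp
    obtain ⟨q', rfl⟩ := hq
    exact ⟨p' + q', Polynomial.derivative_add⟩
  | monomial n a =>
    refine ⟨Polynomial.monomial (n + 1) (a / (n + 1)), ?_⟩
    have : (n : ℝ) + 1 ≠ 0 := by positivity
    rw [Polynomial.derivative_monomial]
    push_cast
    rw [div_mul_cancel₀ _ this]

open scoped ContDiff in
/-- Weierstrass approximation together with finitely many derivatives. -/
theorem exists_polynomial_derivBound (M : ℕ) {v : ℝ → ℝ} (hv : ContDiff ℝ ∞ v) {ε : ℝ}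
    (hε : 0 < ε) : ∃ Q : Polynomial ℝ, DerivBound M ε (fun z => v z - Q.eval z) := by
  induction M generalizing v with
  | zero =>
    obtain ⟨Q, hQ⟩ := exists_polynomial_near_of_continuousOn (-1) 1 v
      hv.continuous.continuousOn ε hε
    refine ⟨Q, fun j hj z hz => ?_⟩
    obtain rfl : j = 0 := by omega
    rw [iteratedDeriv_zero, abs_sub_comm]
    exact (hQ z hz).le
  | succ M ih =>
    obtain ⟨hvd, hv'⟩ := contDiff_infty_iff_deriv.1 hv
    obtain ⟨Q', hQ'⟩ := ih hv'
    obtain ⟨q, rfl⟩ := exists_derivative_eq Q'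
    refine ⟨q + Polynomial.C (v 0 - q.eval 0), ?_⟩
    set d : ℝ → ℝ := fun z => v z - (q + Polynomial.C (v 0 - q.eval 0)).eval z with hd
    have hder : ∀ z, HasDerivAt d (deriv v z - (Polynomial.derivative q).eval z) z := fun z => by
      refine ((hvd z).hasDerivAt.sub
        ((q + Polynomial.C (v 0 - q.eval 0)).hasDerivAt z)).congr_deriv ?_
      simp
    have hd0 : d 0 = 0 := by simp [hd]
    have hdd : deriv d = fun z => deriv v z - (Polynomial.derivative q).eval z :=
      funext fun z => (hder z).deriv
    intro j hj z hz
    rcases j with _ | j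
    · have := (convex_Icc (-1 : ℝ) 1).norm_image_sub_le_of_norm_hasDerivWithin_le
        (fun y _ => (hder y).hasDerivWithinAt) (fun y hy => hQ'.abs_le hy)
        (show (0 : ℝ) ∈ Icc (-1 : ℝ) 1 by norm_num) hz
      rw [hd0, sub_zero, sub_zero, Real.norm_eq_abs, Real.norm_eq_abs] at this
      rw [iteratedDeriv_zero]
      exact this.trans (mul_le_of_le_one_right hε.le (abs_le.2 hz))
    · rw [iteratedDeriv_succ', hdd]
      exact hQ' j (by omega) z hz

theorem wInt_one_sub_sq_pow_mul {β : ℝ} (hβ : 0 ≤ β) (M : ℕ) (F : ℝ → ℝ) :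
    wInt β (fun z => (1 - z ^ 2) ^ M * F z) = wInt (β + M) F := by
  induction M generalizing β with
  | zero => simp
  | succ M ih =>
    have : (fun z => (1 - z ^ 2) ^ (M + 1) * F z)
        = fun z => (1 - z ^ 2) * ((1 - z ^ 2) ^ M * F z) := by ext z; ring
    rw [this, wInt_one_sub_sq_mul hβ, ih (by linarith)]
    push_cast
    rw [add_assoc β 1, add_comm (1 : ℝ)]

/-- An integrable majorant on `(0, ∞)` for `min (1, ξ^{-M}) ξ^{α - 1/2}`. -/
noncomputable def tailBound (α : ℝ) (M : ℕ) (ξ : ℝ) : ℝ :=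
  (Ioc 0 1).indicator (fun ξ => ξ ^ (α - 1 / 2)) ξ
    + (Ioi 1).indicator (fun ξ => ξ ^ (α - 1 / 2 - M)) ξ

theorem integrable_tailBound {α : ℝ} (hα : 1 / 2 ≤ α) {M : ℕ} (hM : α + 1 ≤ M) :
    Integrable (tailBound α M) := by
  refine Integrable.add ?_ ?_
  · rw [integrable_indicator_iff measurableSet_Ioc]
    have := (intervalIntegral.intervalIntegrable_rpow' (a := 0) (b := 1) (r := α - 1 / 2)
      (by linarith))
    rwa [intervalIntegrable_iff_integrableOn_Ioc_of_le zero_le_one] at this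
  · rw [integrable_indicator_iff measurableSet_Ioi]
    exact integrableOn_Ioi_rpow_of_lt (by linarith) one_pos

open scoped ContDiff in
theorem exists_abs_pairing_le {α : ℝ} (hα : 1 / 2 ≤ α) (M k : ℕ) :
    ∃ C, 0 ≤ C ∧ ∀ (r : ℝ → ℝ) (ε : ℝ), ContDiff ℝ ∞ r → DerivBound M ε r → ∀ ξ : ℝ, 0 < ξ →
      |cosT α (fun z => (1 - z ^ 2) ^ M * r z) ξ * (ξ ^ (α - 1 / 2) * besselJ α k ξ)|
        ≤ C * ε * tailBound α M ξ := by
  obtain ⟨C₁, hC₁, h₁⟩ := exists_abs_pow_mul_wInt_le M 1 (show 0 ≤ α by linarith)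
  obtain ⟨B, hB0, hB⟩ := (besselSystem_besselJ hα).exists_abs_le
  refine ⟨(2 + C₁) * B, by positivity, fun r ε hr hε ξ hξ => ?_⟩
  have e0 : cosT α (fun z => (1 - z ^ 2) ^ M * r z) ξ
      = wInt (α + M) (fun z => r z * Real.cos (ξ * z)) := by
    simp only [cosT, mul_assoc]
    exact wInt_one_sub_sq_pow_mul (by linarith) M _
  have hε0 := hε.nonneg
  have e1 : |cosT α (fun z => (1 - z ^ 2) ^ M * r z) ξ| ≤ 2 * ε := by
    rw [e0]
    refine abs_wInt_le (by positivity) fun z hz => ?_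
    rw [abs_mul]
    exact (mul_le_of_le_one_right (abs_nonneg _) (Real.abs_cos_le_one _)).trans (hε.abs_le hz)
  have e2 : ξ ^ M * |cosT α (fun z => (1 - z ^ 2) ^ M * r z) ξ| ≤ C₁ * ε := by
    have := h₁ r ε hr hε ξ 0
    simp only [Polynomial.eval_one, one_mul, add_zero] at this
    rwa [← e0, abs_mul, abs_of_pos (pow_pos hξ M)] at this
  rw [abs_mul, abs_mul, abs_of_nonneg (Real.rpow_nonneg hξ.le _)]
  have hb := hB k ξ hξ
  have hp := Real.rpow_nonneg hξ.le (α - 1 / 2)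
  rcases le_or_gt ξ 1 with h | h
  · have ht : tailBound α M ξ = ξ ^ (α - 1 / 2) := by
      simp [tailBound, hξ, h]
    rw [ht]
    calc _ ≤ (2 * ε) * (ξ ^ (α - 1 / 2) * B) := by gcongr
      _ = 2 * B * ε * ξ ^ (α - 1 / 2) := by ring
      _ ≤ _ := by gcongr; linarith
  · have ht : tailBound α M ξ = ξ ^ (α - 1 / 2) / ξ ^ M := by
      rw [← Real.rpow_sub_natCast hξ.ne']
      simp [tailBound, h]
    have e3 : |cosT α (fun z => (1 - z ^ 2) ^ M * r z) ξ| ≤ C₁ * ε / ξ ^ M := by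
      rw [le_div_iff₀ (pow_pos hξ M)]; linarith
    rw [ht]
    calc _ ≤ (C₁ * ε / ξ ^ M) * (ξ ^ (α - 1 / 2) * B) := by gcongr
      _ = C₁ * B * ε * (ξ ^ (α - 1 / 2) / ξ ^ M) := by ring
      _ ≤ _ := by gcongr; linarith

open scoped ContDiff in
theorem besselPairing_smooth {α : ℝ} (hα : 1 / 2 ≤ α) {M : ℕ} (hM : α + 1 ≤ M) {k : ℕ}
    (hk : Even k) {v : ℝ → ℝ} (hv : ContDiff ℝ ∞ v) :
    BesselPairing α k (pairingConst α k) (fun z => (1 - z ^ 2) ^ M * v z) := by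
  obtain ⟨C, hC, hle⟩ := exists_abs_pairing_le hα M k
  have hT := integrable_tailBound hα hM
  obtain ⟨B, hB0, hB⟩ := exists_abs_le_of_continuous (continuous_jacobiP α k)
  have hα0 : 0 ≤ α := by linarith
  have hmeas : ∀ r : ℝ → ℝ, Continuous r → AEStronglyMeasurable
      (fun ξ => cosT α (fun z => (1 - z ^ 2) ^ M * r z) ξ * (ξ ^ (α - 1 / 2) * besselJ α k ξ))
      (volume.restrict (Ioi 0)) := fun r hr =>
    (((continuous_cosT hα0 (by fun_prop)).continuousOn).mul
      ((continuousOn_id.rpow_const fun x hx => Or.inl (mem_Ioi.1 hx).ne').mul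
        ((besselSystem_besselJ hα).continuousOn k))).aestronglyMeasurable measurableSet_Ioi
  have hint : ∀ (r : ℝ → ℝ) (ε : ℝ), ContDiff ℝ ∞ r → DerivBound M ε r → IntegrableOn
      (fun ξ => cosT α (fun z => (1 - z ^ 2) ^ M * r z) ξ * (ξ ^ (α - 1 / 2) * besselJ α k ξ))
      (Ioi 0) := fun r ε hr hε =>
    Integrable.mono' (hT.integrableOn.const_mul (C * ε)) (hmeas r hr.continuous)
      ((ae_restrict_iff' measurableSet_Ioi).2 (Eventually.of_forall fun ξ hξ => hle r ε hr hε ξ hξ))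
  have happrox : ∀ ε > 0,
      IntegrableOn (fun ξ => cosT α (fun z => (1 - z ^ 2) ^ M * v z) ξ
        * (ξ ^ (α - 1 / 2) * besselJ α k ξ)) (Ioi 0) ∧
      |(∫ ξ in Ioi 0, cosT α (fun z => (1 - z ^ 2) ^ M * v z) ξ
          * (ξ ^ (α - 1 / 2) * besselJ α k ξ))
        - pairingConst α k * wInt α (fun z => (1 - z ^ 2) ^ M * v z * jacobiP α α k z)|
        ≤ (C * (∫ ξ in Ioi 0, tailBound α M ξ) + |pairingConst α k| * (2 * B)) * ε := by
    intro ε hε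
    obtain ⟨Q, hQ⟩ := exists_polynomial_derivBound M hv hε
    have hr : ContDiff ℝ ∞ (fun z => v z - Q.eval z) := hv.sub <| by
      have := Q.contDiff_aeval (𝕜 := ℝ) ∞
      simpa only [Polynomial.coe_aeval_eq_eval] using this
    have hF := besselPairing_polynomial hα hk ((1 - Polynomial.X ^ 2) ^ M * Q)
    simp only [Polynomial.eval_mul, Polynomial.eval_pow, Polynomial.eval_sub, Polynomial.eval_one,
      Polynomial.eval_X] at hF
    have hR := hint _ ε hr hQ
    have c1 := hv.continuous
    have c2 := Q.continuous
    have c3 := continuous_jacobiP α k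
    have hsplit : (fun z => (1 - z ^ 2) ^ M * v z)
        = fun z => (1 - z ^ 2) ^ M * Q.eval z + (1 - z ^ 2) ^ M * (v z - Q.eval z) := by
      ext z; ring
    have hct : ∀ ξ, cosT α (fun z => (1 - z ^ 2) ^ M * v z) ξ
        = cosT α (fun z => (1 - z ^ 2) ^ M * Q.eval z) ξ
          + cosT α (fun z => (1 - z ^ 2) ^ M * (v z - Q.eval z)) ξ := fun ξ => by
      rw [hsplit, cosT_add hα0 (by fun_prop) (by fun_prop)]
    have hw : wInt α (fun z => (1 - z ^ 2) ^ M * v z * jacobiP α α k z)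
        = wInt α (fun z => (1 - z ^ 2) ^ M * Q.eval z * jacobiP α α k z)
          + wInt α (fun z => (1 - z ^ 2) ^ M * (v z - Q.eval z) * jacobiP α α k z) := by
      rw [← wInt_add hα0 (by fun_prop) (by fun_prop)]
      congr 1; ext z; ring
    simp only [hct, add_mul]
    refine ⟨hF.1.add hR, ?_⟩
    rw [integral_add hF.1 hR, hF.2, hw]
    have b1 : |∫ ξ in Ioi 0, cosT α (fun z => (1 - z ^ 2) ^ M * (v z - Q.eval z)) ξ
        * (ξ ^ (α - 1 / 2) * besselJ α k ξ)| ≤ C * (∫ ξ in Ioi 0, tailBound α M ξ) * ε := by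
      have := norm_integral_le_of_norm_le (f := fun ξ =>
          cosT α (fun z => (1 - z ^ 2) ^ M * (v z - Q.eval z)) ξ
            * (ξ ^ (α - 1 / 2) * besselJ α k ξ)) (hT.integrableOn (s := Ioi 0) |>.const_mul (C * ε))
        ((ae_restrict_iff' measurableSet_Ioi).2
          (Eventually.of_forall fun ξ hξ => hle _ ε hr hQ ξ hξ))
      rw [integral_const_mul] at this
      calc _ ≤ _ := this
        _ = _ := by ring
    have b2 : |pairingConst α k
        * wInt α (fun z => (1 - z ^ 2) ^ M * (v z - Q.eval z) * jacobiP α α k z)|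
        ≤ |pairingConst α k| * (2 * B) * ε := by
      rw [abs_mul, mul_assoc]
      refine mul_le_mul_of_nonneg_left ?_ (abs_nonneg _)
      rw [mul_assoc]
      refine abs_wInt_le hα0 fun z hz => ?_
      have h1 := hQ.abs_le hz
      have h2 := hB z hz
      have h3 := one_sub_sq_mem hz
      rw [abs_mul, abs_mul, abs_pow, abs_of_nonneg h3.1, mul_comm B]
      have h4 : (1 - z ^ 2) ^ M ≤ 1 := pow_le_one₀ h3.1 h3.2
      calc _ ≤ 1 * ε * B := by gcongr
        _ = _ := by ring
    rw [mul_add, add_sub_add_left_eq_sub]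
    exact (abs_sub _ _).trans (add_le_add b1 b2)
  refine ⟨(happrox 1 one_pos).1, ?_⟩
  set K := C * (∫ ξ in Ioi 0, tailBound α M ξ) + |pairingConst α k| * (2 * B) with hK
  have hK0 : 0 ≤ K := by
    simpa using (abs_nonneg _).trans (happrox 1 one_pos).2
  refine sub_eq_zero.1 (abs_eq_zero.1 (le_antisymm (le_of_forall_pos_le_add fun ε hε => ?_)
    (abs_nonneg _)))
  have h1 := (happrox (ε / (K + 1)) (by positivity)).2
  refine h1.trans ?_
  rw [zero_add, mul_div_assoc', div_le_iff₀ (by positivity)]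
  nlinarith

theorem integral_eq_zero_of_odd {E : Type*} [NormedAddCommGroup E] [NormedSpace ℝ E] {F : ℝ → E}
    (hF : ∀ z, F (-z) = -F z) : ∫ z, F z = 0 := by
  have h := integral_neg_eq_self F volume
  simp only [hF, integral_neg] at h
  rw [neg_eq_iff_add_eq_zero, ← two_smul ℝ] at h
  exact (smul_eq_zero.1 h).resolve_left two_ne_zero

theorem hasCompactSupport_of_eq_zero {g : ℝ → ℝ} (hsupp : ∀ z, 1 < |z| → g z = 0) :
    HasCompactSupport g :=
  HasCompactSupport.intro (isCompact_Icc (a := (-1 : ℝ)) (b := 1)) fun z hz => hsupp z <| by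
    by_contra h
    exact hz (abs_le.1 (not_lt.1 h))

/-- Multiplying the cosine transform by that of an approximate identity. -/
theorem abs_integral_convolution_mul_cos_le {φ g : ℝ → ℝ} (hφ : Continuous φ)
    (hφc : HasCompactSupport φ) (hφ0 : ∀ t, 0 ≤ φ t) (hφ1 : ∫ t, φ t = 1) (hg : Continuous g)
    (hgc : HasCompactSupport g) (heven : ∀ z, g (-z) = g z) (ξ : ℝ) :
    |∫ z, (∫ t, φ t * g (z - t)) * Real.cos (ξ * z)| ≤ |∫ z, g z * Real.cos (ξ * z)| := by
  have hint : ∀ {c : ℝ → ℝ}, Continuous c → Integrable fun z => g z * c z := fun hc =>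
    (hg.mul hc).integrable_of_hasCompactSupport hgc.mul_right
  have hsupp : HasCompactSupport
      (Function.uncurry fun z t : ℝ => φ t * g (z - t) * Real.cos (ξ * z)) := by
    refine HasCompactSupport.intro (K := (fun p : ℝ × ℝ => (p.1 + p.2, p.2)) ''
      (tsupport g ×ˢ tsupport φ))
      ((hgc.isCompact.prod hφc.isCompact).image (by fun_prop)) ?_
    rintro ⟨z, t⟩ hz
    simp only [Function.uncurry_apply_pair]
    by_cases ht : t ∈ tsupport φ
    · by_cases hzt : z - t ∈ tsupport g
      · exact absurd ⟨(z - t, t), ⟨hzt, ht⟩, by simp⟩ hz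
      · simp [image_eq_zero_of_notMem_tsupport hzt]
    · simp [image_eq_zero_of_notMem_tsupport ht]
  have hodd : ∫ s, g s * Real.sin (ξ * s) = 0 :=
    integral_eq_zero_of_odd fun s => by rw [heven, mul_neg, Real.sin_neg, mul_neg]
  have hinner : ∀ t, ∫ z, φ t * g (z - t) * Real.cos (ξ * z) =
      φ t * Real.cos (ξ * t) * ∫ s, g s * Real.cos (ξ * s) := fun t => by
    rw [← integral_add_right_eq_self (fun z => φ t * g (z - t) * Real.cos (ξ * z)) t]
    have h : ∀ s, φ t * g (s + t - t) * Real.cos (ξ * (s + t)) =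
        φ t * Real.cos (ξ * t) * (g s * Real.cos (ξ * s)) -
          φ t * Real.sin (ξ * t) * (g s * Real.sin (ξ * s)) := fun s => by
      rw [add_sub_cancel_right, mul_add, Real.cos_add]
      ring
    simp only [h]
    rw [integral_sub ((hint (by fun_prop)).const_mul _) ((hint (by fun_prop)).const_mul _),
      integral_const_mul, integral_const_mul, hodd, mul_zero, sub_zero]
  have hswap : ∫ z, (∫ t, φ t * g (z - t)) * Real.cos (ξ * z) =
      (∫ t, φ t * Real.cos (ξ * t)) * ∫ s, g s * Real.cos (ξ * s) := by
    simp only [← integral_mul_const]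
    rw [integral_integral_swap_of_hasCompactSupport (by fun_prop) hsupp]
    simp only [hinner, integral_mul_const]
  have hφi : Integrable φ := hφ.integrable_of_hasCompactSupport hφc
  have hφcos : |∫ t, φ t * Real.cos (ξ * t)| ≤ 1 := by
    rw [← hφ1, ← Real.norm_eq_abs]
    refine norm_integral_le_of_norm_le hφi (ae_of_all _ fun t => ?_)
    rw [norm_mul, Real.norm_of_nonneg (hφ0 t)]
    exact mul_le_of_le_one_right (hφ0 t) (Real.abs_cos_le_one _)
  rw [hswap, abs_mul]
  exact mul_le_of_le_one_left (abs_nonneg _) hφcos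

open scoped ContDiff in
/-- Smooth approximation with support compactly inside `(-1, 1)` preserving the decay of the
cosine transform. -/
theorem exists_contDiff_approx {g : ℝ → ℝ} {C σ : ℝ} (hg : Continuous g)
    (hsupp : ∀ z, 1 < |z| → g z = 0) (heven : ∀ z, g (-z) = g z) (hC : 0 ≤ C) (hσ : 0 ≤ σ)
    (hdecay : ∀ ξ, 0 < ξ → |∫ z, g z * Real.cos (ξ * z)| ≤ C / ξ ^ σ) {ε : ℝ} (hε : 0 < ε) :
    ∃ (u : ℝ → ℝ) (δ : ℝ), ContDiff ℝ ∞ u ∧ 0 < δ ∧ (∀ z, 1 - δ ≤ |z| → u z = 0) ∧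
      (∀ z ∈ Icc (-1 : ℝ) 1, |u z - g z| ≤ ε) ∧
      ∀ ξ, 0 < ξ → |∫ z, u z * Real.cos (ξ * z)| ≤ 2 ^ σ * C / ξ ^ σ := by
  have hgc := hasCompactSupport_of_eq_zero hsupp
  obtain ⟨η, hη, hu⟩ := Metric.uniformContinuous_iff.1
    (hgc.uniformContinuous_of_continuous hg) (ε / 2) (by positivity)
  set δ := min (1 / 4) (η / 5) with hδ
  have hδ0 : 0 < δ := by positivity
  have hδ1 : δ ≤ 1 / 4 := min_le_left _ _
  have hδ2 : δ ≤ η / 5 := min_le_right _ _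
  set r := 1 - 2 * δ with hr
  have hr0 : 1 / 2 ≤ r := by linarith
  have hrpos : 0 < r := by linarith
  have hr1 : r ≤ 1 := by linarith
  set G : ℝ → ℝ := fun z => g (z / r) with hG
  have hGcont : Continuous G := by fun_prop
  have hG0 : ∀ z, r < |z| → G z = 0 := fun z hz => hsupp _ <| by
    rw [abs_div, abs_of_pos hrpos, one_lt_div hrpos]; exact hz
  have hGc : HasCompactSupport G := hasCompactSupport_of_eq_zero fun z hz => hG0 z (by linarith)
  have hGeven : ∀ z, G (-z) = G z := fun z => by simp only [hG, neg_div, heven]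
  let φ : ContDiffBump (0 : ℝ) := ⟨δ / 2, δ, by positivity, by linarith⟩
  have hφ0 : ∀ t, δ ≤ |t| → φ.normed volume t = 0 := fun t ht => by
    have : t ∉ Function.support (φ.normed volume) := by
      rw [φ.support_normed_eq]
      simpa using ht
    simpa using this
  refine ⟨fun z => ∫ t, φ.normed volume t * G (z - t), δ, ?_, hδ0, fun z hz => ?_, fun z hz => ?_,
    fun ξ hξ => ?_⟩
  · exact φ.hasCompactSupport_normed.contDiff_convolution_left (ContinuousLinearMap.lsmul ℝ ℝ)
      φ.contDiff_normed hGcont.locallyIntegrable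
  · refine integral_eq_zero_of_ae (ae_of_all _ fun t => ?_)
    by_cases ht : δ ≤ |t|
    · simp [hφ0 t ht]
    · have : r < |z - t| := by
        have := abs_sub_abs_le_abs_sub z t
        linarith
      simp [hG0 _ this]
  · have hconv : dist (∫ t, φ.normed volume t * G (z - t)) (G z) ≤ ε / 2 := by
      refine φ.dist_normed_convolution_le (μ := volume) hGcont.aestronglyMeasurable fun y hy => ?_
      refine (hu ?_).le
      rw [Metric.mem_ball, Real.dist_eq] at hy
      rw [Real.dist_eq, ← sub_div, abs_div, abs_of_pos hrpos, div_lt_iff₀ hrpos]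
      have : φ.rOut = δ := rfl
      nlinarith
    have hdil : dist (G z) (g z) ≤ ε / 2 := by
      refine (hu ?_).le
      rw [Real.dist_eq, show z / r - z = z * (2 * δ) / r by rw [hr] at hrpos ⊢; field_simp; ring,
        abs_div, abs_mul, abs_of_pos hrpos, abs_of_pos (by positivity : 0 < 2 * δ),
        div_lt_iff₀ hrpos]
      have := abs_le.2 hz
      nlinarith [abs_nonneg z]
    have := dist_triangle (∫ t, φ.normed volume t * G (z - t)) (G z) (g z)
    rw [← Real.dist_eq]
    linarith
  · refine (abs_integral_convolution_mul_cos_le φ.continuous_normed φ.hasCompactSupport_normed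
      φ.nonneg_normed φ.integral_normed hGcont hGc hGeven ξ).trans ?_
    have hdil : ∫ z, G z * Real.cos (ξ * z) = r * ∫ z, g z * Real.cos (r * ξ * z) := by
      have := Measure.integral_comp_div (fun z => g z * Real.cos (r * ξ * z)) r
      rw [abs_of_pos hrpos, smul_eq_mul] at this
      rw [← this]
      refine integral_congr_ae (ae_of_all _ fun z => ?_)
      simp only [hG]
      rw [show r * ξ * (z / r) = ξ * z by field_simp]
    rw [hdil, abs_mul, abs_of_pos hrpos]
    calc r * |∫ z, g z * Real.cos (r * ξ * z)| ≤ 1 * |∫ z, g z * Real.cos (r * ξ * z)| := by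
          gcongr
      _ ≤ C / (r * ξ) ^ σ := by rw [one_mul]; exact hdecay _ (by positivity)
      _ ≤ C / (ξ / 2) ^ σ := by gcongr; nlinarith
      _ = 2 ^ σ * C / ξ ^ σ := by
          rw [Real.div_rpow hξ.le (by norm_num)]
          field_simp

section cosine_decay

variable {u g : ℝ → ℝ} {α μ δ C D : ℝ}

open scoped ContDiff Topology in
theorem contDiff_mul_one_sub_sq_rpow (hu : ContDiff ℝ ∞ u) (hδ : 0 < δ)
    (hu0 : ∀ z, 1 - δ ≤ |z| → u z = 0) (γ : ℝ) :
    ContDiff ℝ ∞ fun z => u z * (1 - z ^ 2) ^ γ := by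
  refine contDiff_iff_contDiffAt.2 fun z => ?_
  by_cases hz : |z| < 1
  · have : 1 - z ^ 2 ≠ 0 := by have := (sq_lt_one_iff_abs_lt_one z).2 hz; linarith
    exact hu.contDiffAt.mul ((contDiff_const.sub (contDiff_id.pow 2)).contDiffAt.rpow_const_of_ne
      this)
  · have h : (fun z => u z * (1 - z ^ 2) ^ γ) =ᶠ[𝓝 z] fun _ => 0 := by
      filter_upwards [continuous_abs.continuousAt.eventually
        (lt_mem_nhds (show 1 - δ < |z| by linarith))] with y hy
      rw [hu0 y hy.le, zero_mul]
    exact contDiffAt_const.congr_of_eventuallyEq h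

theorem wInt_eq_integral (hu0 : ∀ z, 1 ≤ |z| → u z = 0) (α : ℝ) (M : ℕ) (c : ℝ → ℝ) :
    wInt α (fun z => (1 - z ^ 2) ^ M * (u z * (1 - z ^ 2) ^ (-(α + M))) * c z) =
      ∫ z in (-1 : ℝ)..1, u z * c z := by
  refine intervalIntegral.integral_congr fun z hz => ?_
  rw [uIcc_of_le (by norm_num)] at hz
  simp only
  by_cases h : 1 ≤ |z|
  · simp [hu0 z h]
  · have : 0 < 1 - z ^ 2 := by
      have := (sq_lt_one_iff_abs_lt_one z).2 (not_le.1 h); linarith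
    have h1 : (1 - z ^ 2) ^ α * ((1 - z ^ 2) ^ M * (1 - z ^ 2) ^ (-(α + M))) = 1 := by
      rw [← Real.rpow_natCast _ M, ← Real.rpow_add this, ← Real.rpow_add this]
      simp
    linear_combination (u z * c z) * h1

theorem integral_eq_intervalIntegral (hu0 : ∀ z, 1 ≤ |z| → u z = 0) (c : ℝ → ℝ) :
    ∫ z in (-1 : ℝ)..1, u z * c z = ∫ z, u z * c z := by
  refine intervalIntegral.integral_eq_integral_of_support_subset fun z hz => ?_
  by_contra h
  refine hz ?_
  simp only
  rw [hu0 z ?_, zero_mul]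
  by_contra h2
  have := abs_lt.1 (not_le.1 h2)
  exact h ⟨this.1, this.2.le⟩

open scoped ContDiff in
theorem abs_pairingConst_mul_le_of_contDiff (hα : 1 / 2 ≤ α) (hμ0 : 0 ≤ μ) (hμ : μ < 1 / 2)
    (hC : ∀ n x, 0 < x → |besselJ α n x| ≤ C) {k : ℕ} (hk : Even k) (hk2 : 2 ≤ k)
    (hD : 0 ≤ D) (hu : ContDiff ℝ ∞ u) (hδ : 0 < δ) (hu0 : ∀ z, 1 - δ ≤ |z| → u z = 0)
    (hdecay : ∀ ξ, 0 < ξ → |∫ z, u z * Real.cos (ξ * z)| ≤ D / ξ ^ (α + 1 - μ)) :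
    |pairingConst α k| * |∫ z in (-1 : ℝ)..1, u z * jacobiP α α k z| ≤
      D * (C * (1 / (μ + 1 / 2) + 1 / (1 / 2 - μ)) * (α + 1 / 2 + k) ^ (μ - 1 / 2)) := by
  obtain ⟨M, hM⟩ := exists_nat_ge (α + 1)
  have hu1 : ∀ z, 1 ≤ |z| → u z = 0 := fun z hz => hu0 z (by linarith)
  have hpair := (besselPairing_smooth hα hM hk
    (contDiff_mul_one_sub_sq_rpow hu hδ hu0 (-(α + M)))).2
  rw [wInt_eq_integral hu1] at hpair
  obtain ⟨hint, hle⟩ := (besselSystem_besselJ hα).integrableOn_rpow_and_integral_le hC hk2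
    hμ0 hμ
  rw [← abs_mul, ← hpair, ← Real.norm_eq_abs]
  refine (norm_integral_le_of_norm_le (hint.const_mul D)
    ((ae_restrict_mem measurableSet_Ioi).mono fun ξ hξ => ?_)).trans ?_
  · have hξ' : (0 : ℝ) < ξ := hξ
    rw [cosT, wInt_eq_integral hu1, integral_eq_intervalIntegral hu1, norm_mul, norm_mul,
      Real.norm_of_nonneg (Real.rpow_nonneg hξ'.le _), Real.norm_eq_abs, Real.norm_eq_abs]
    calc _ ≤ D / ξ ^ (α + 1 - μ) * (ξ ^ (α - 1 / 2) * |besselJ α k ξ|) := by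
          gcongr
          exact hdecay ξ hξ'
      _ = D * (ξ ^ (μ - 3 / 2) * |besselJ α k ξ|) := by
          have h : ξ ^ (μ - 3 / 2) = ξ ^ (α - 1 / 2) / ξ ^ (α + 1 - μ) := by
            rw [← Real.rpow_sub hξ']
            ring_nf
          rw [h]
          field_simp
  · rw [integral_const_mul]
    exact mul_le_mul_of_nonneg_left hle hD

theorem abs_pairingConst_mul_le (hα : 1 / 2 ≤ α) (hμ0 : 0 ≤ μ) (hμ : μ < 1 / 2)
    (hC : ∀ n x, 0 < x → |besselJ α n x| ≤ C) {k : ℕ} (hk : Even k) (hk2 : 2 ≤ k)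
    (hD : 0 ≤ D) (hg : Continuous g) (hsupp : ∀ z, 1 < |z| → g z = 0)
    (heven : ∀ z, g (-z) = g z)
    (hdecay : ∀ ξ, 0 < ξ → |∫ z, g z * Real.cos (ξ * z)| ≤ D / ξ ^ (α + 1 - μ)) :
    |pairingConst α k| * |∫ z in (-1 : ℝ)..1, g z * jacobiP α α k z| ≤
      2 ^ (α + 1 - μ) * D *
        (C * (1 / (μ + 1 / 2) + 1 / (1 / 2 - μ)) * (α + 1 / 2 + k) ^ (μ - 1 / 2)) := by
  obtain ⟨B, hB0, hB⟩ := exists_abs_le_of_continuous (continuous_jacobiP α k)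
  set L := |pairingConst α k| with hL
  have hL0 : 0 ≤ L := abs_nonneg _
  refine le_of_forall_pos_le_add fun ε hε => ?_
  have hs : 0 < 2 * L * B + 1 := by positivity
  obtain ⟨u, δ, hu, hδ, hu0, hclose, hud⟩ := exists_contDiff_approx hg hsupp heven hD
    (by linarith) hdecay (div_pos hε hs)
  have h1 := abs_pairingConst_mul_le_of_contDiff hα hμ0 hμ hC hk hk2 (by positivity) hu hδ
    hu0 hud
  have hP := continuous_jacobiP α k
  have hu' := hu.continuous
  have h2 : |(∫ z in (-1 : ℝ)..1, g z * jacobiP α α k z) -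
      ∫ z in (-1 : ℝ)..1, u z * jacobiP α α k z| ≤ 2 * (ε / (2 * L * B + 1) * B) := by
    rw [← intervalIntegral.integral_sub (Continuous.intervalIntegrable (by fun_prop) _ _)
      (Continuous.intervalIntegrable (by fun_prop) _ _)]
    have := intervalIntegral.norm_integral_le_of_norm_le_const (a := (-1 : ℝ)) (b := 1)
      (f := fun z => g z * jacobiP α α k z - u z * jacobiP α α k z)
      (C := ε / (2 * L * B + 1) * B) fun z hz => by
        rw [uIoc_of_le (by norm_num)] at hz
        have hz' := Ioc_subset_Icc_self hz
        rw [← sub_mul, norm_mul, Real.norm_eq_abs, Real.norm_eq_abs, abs_sub_comm]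
        exact mul_le_mul (hclose z hz') (hB z hz') (abs_nonneg _) (by positivity)
    rw [Real.norm_eq_abs] at this
    refine this.trans_eq ?_
    norm_num
    ring
  have h3 : L * (2 * (ε / (2 * L * B + 1) * B)) ≤ ε := by
    rw [show L * (2 * (ε / (2 * L * B + 1) * B)) = ε * ((2 * L * B) / (2 * L * B + 1)) by ring]
    exact mul_le_of_le_one_right hε.le ((div_le_one hs).2 (by linarith))
  have h4 := abs_sub_abs_le_abs_sub (∫ z in (-1 : ℝ)..1, g z * jacobiP α α k z)
    (∫ z in (-1 : ℝ)..1, u z * jacobiP α α k z)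
  have h5 := mul_le_mul_of_nonneg_left (h4.trans h2) hL0
  rw [mul_sub] at h5
  linarith

end cosine_decay

theorem exists_factorial_mul_rpow_le {α : ℝ} (hα : 0 < α) :
    ∃ K, 0 < K ∧ ∀ k : ℕ, (k : ℝ) ^ α * k.factorial ≤ K * Real.Gamma (α + k + 1) := by
  obtain ⟨K, hK⟩ := (Real.GammaSeq_tendsto_Gamma α).bddAbove_range
  have hprod : ∀ k : ℕ,
      Real.Gamma (α + k + 1) = (∏ j ∈ Finset.range (k + 1), (α + j)) * Real.Gamma α := fun k => by
    induction k with
    | zero => simp [Real.Gamma_add_one hα.ne']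
    | succ k ih =>
      have : α + ((k + 1 : ℕ) : ℝ) ≠ 0 := by positivity
      rw [Real.Gamma_add_one this, Finset.prod_range_succ, mul_right_comm, ← ih]
      push_cast
      ring_nf
  have hG := Real.Gamma_pos_of_pos hα
  refine ⟨(|K| + 1) / Real.Gamma α, by positivity, fun k => ?_⟩
  have hpos : 0 < ∏ j ∈ Finset.range (k + 1), (α + j) :=
    Finset.prod_pos fun j _ => by positivity
  have h := hK ⟨k, rfl⟩
  rw [Real.GammaSeq, div_le_iff₀ hpos] at h
  rw [hprod, show (|K| + 1) / Real.Gamma α * ((∏ j ∈ Finset.range (k + 1), (α + j)) *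
    Real.Gamma α) = (|K| + 1) * ∏ j ∈ Finset.range (k + 1), (α + j) by field_simp]
  refine h.trans (mul_le_mul_of_nonneg_right ?_ hpos.le)
  linarith [le_abs_self K]

section coefficients

variable {l μ C D : ℝ}

theorem exists_abs_pairingConst_mul_jacobiNormSq (hl : -(1 / 2) ≤ l) :
    ∃ A, 0 < A ∧ ∀ k : ℕ, Even k → |pairingConst (l + 1) k| * jacobiNormSq l k =
      A * (Real.Gamma (l + 1 + k + 1) / (k.factorial * (l + 1 + 1 / 2 + k))) := by
  have hα : 1 / 2 ≤ l + 1 := by linarith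
  have hI := integral_besselJ_sq_pos hα
  have hc := cosInt_zero_pos (β := l + 1) (by linarith)
  have h0 := jacobiNormSq_pos (l := l) (by linarith) 0
  set I := ∫ x in Ioi 0, besselJ (l + 1) 0 x * besselJ (l + 1) 0 x / x with hIdef
  refine ⟨(l + 1 + 1 / 2) * I / (cosInt (l + 1) 0 / jacobiNormSq l 0), ?_, fun k hk => ?_⟩
  · have : 0 < l + 1 + 1 / 2 := by linarith
    positivity
  · have hν : 0 < l + 1 + 1 / 2 + k := by
      have : (0 : ℝ) ≤ k := k.cast_nonneg
      linarith
    have hk0 := jacobiNormSq_pos (l := l) (by linarith) k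
    have hΓ := Real.Gamma_pos_of_pos (s := l + 1 + k + 1) (by linarith)
    have hsq := (besselSystem_besselJ hα).integral_sq k
    rw [← hIdef] at hsq
    have hIk : ∫ x in Ioi 0, besselJ (l + 1) k x * besselJ (l + 1) k x / x =
        (l + 1 + 1 / 2) * I / (l + 1 + 1 / 2 + k) := by
      rw [eq_div_iff hν.ne', mul_comm]
      exact hsq
    have hcos : |Real.cos (k * (Real.pi / 2))| = 1 := by
      obtain ⟨m, rfl⟩ := hk
      rw [show ((m + m : ℕ) : ℝ) * (Real.pi / 2) = m * Real.pi by push_cast; ring]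
      exact Real.abs_cos_int_mul_pi m
    have hIk0 : 0 < (l + 1 + 1 / 2) * I / (l + 1 + 1 / 2 + k) := by
      have : 0 < l + 1 + 1 / 2 := by linarith
      positivity
    rw [pairingConst, wInt_jacobiP_sq (by linarith), hIk, abs_div, abs_mul, abs_div, abs_mul, hcos,
      abs_of_pos hΓ, abs_of_pos hIk0, Nat.abs_cast, abs_of_pos (by positivity)]
    field_simp

/-- Decay of the Jacobi coefficients of a continuous even function supported in `[-1, 1]` whose
cosine transform decays like a power. -/
theorem exists_abs_integral_mul_jacobiP_le (hl : -(1 / 2) ≤ l) (hμ0 : 0 ≤ μ) (hμ : μ < 1 / 2)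
    (hD : 0 ≤ D) : ∃ K, 0 < K ∧ ∀ g : ℝ → ℝ, Continuous g → (∀ z, 1 < |z| → g z = 0) →
      (∀ z, g (-z) = g z) →
      (∀ ξ, 0 < ξ → |∫ z, g z * Real.cos (ξ * z)| ≤ D / ξ ^ (l - μ + 2)) →
      ∀ k : ℕ, Even k → 2 ≤ k →
        |∫ z in (-1 : ℝ)..1, g z * jacobiP (l + 1) (l + 1) k z| / jacobiNormSq l k ≤
          K / (k : ℝ) ^ (l - μ + 1 / 2) := by
  have hα : 1 / 2 ≤ l + 1 := by linarith
  obtain ⟨C, hC0, hC⟩ := (besselSystem_besselJ hα).exists_abs_le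
  obtain ⟨A, hA, hΛ⟩ := exists_abs_pairingConst_mul_jacobiNormSq hl
  obtain ⟨K, hK, hKle⟩ := exists_factorial_mul_rpow_le (α := l + 1) (by linarith)
  set E := 2 ^ (l - μ + 2) * D * (C * (1 / (μ + 1 / 2) + 1 / (1 / 2 - μ))) with hE
  have hE0 : 0 ≤ E := by
    have : 0 < 1 / 2 - μ := by linarith
    positivity
  have hν : 0 < l + 1 + 1 / 2 := by linarith
  refine ⟨(E + 1) * K * (l + 1 + 1 / 2 + 1) ^ (μ + 1 / 2) / A, by positivity,
    fun g hg hsupp heven hdecay k hk hk2 => ?_⟩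
  have hk0 : (0 : ℝ) < k := by exact_mod_cast (by omega : 0 < k)
  have hk1 : (1 : ℝ) ≤ k := by exact_mod_cast (by omega : 1 ≤ k)
  have hexp : l + 1 + 1 - μ = l - μ + 2 := by ring
  have hmain := abs_pairingConst_mul_le hα hμ0 hμ hC hk hk2 hD hg hsupp heven
    (by rwa [hexp])
  rw [hexp, ← mul_assoc, ← hE] at hmain
  have hh := jacobiNormSq_pos (l := l) (by linarith) k
  have hΓ := Real.Gamma_pos_of_pos (s := l + 1 + k + 1) (by linarith)
  have hΛk := hΛ k hk
  set Λ := |pairingConst (l + 1) k|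
  set Y := |∫ z in (-1 : ℝ)..1, g z * jacobiP (l + 1) (l + 1) k z|
  set h := jacobiNormSq l k
  set N := l + 1 + 1 / 2 + (k : ℝ) with hN
  have hN0 : 0 < N := by positivity
  have hΛ0 : 0 < Λ := by
    refine pos_of_mul_pos_left (b := h) ?_ hh.le
    rw [hΛk]
    positivity
  have hNpow : N ^ (μ - 1 / 2) * N = N ^ (μ + 1 / 2) := by
    rw [← Real.rpow_add_one hN0.ne']
    ring_nf
  have hNle : N ^ (μ + 1 / 2) ≤ (l + 1 + 1 / 2 + 1) ^ (μ + 1 / 2) * (k : ℝ) ^ (μ + 1 / 2) := by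
    rw [← Real.mul_rpow (by positivity) hk0.le]
    refine Real.rpow_le_rpow hN0.le ?_ (by linarith)
    nlinarith
  have hkpow : (k : ℝ) ^ (μ + 1 / 2) * (k : ℝ) ^ (l - μ + 1 / 2) = (k : ℝ) ^ (l + 1) := by
    rw [← Real.rpow_add hk0]
    ring_nf
  rw [div_le_div_iff₀ hh (by positivity)]
  refine le_of_mul_le_mul_left ?_ hΛ0
  calc Λ * (Y * (k : ℝ) ^ (l - μ + 1 / 2)) = Λ * Y * (k : ℝ) ^ (l - μ + 1 / 2) := by ring
    _ ≤ E * N ^ (μ - 1 / 2) * (k : ℝ) ^ (l - μ + 1 / 2) := by gcongr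
    _ = E * N ^ (μ + 1 / 2) * (k : ℝ) ^ (l - μ + 1 / 2) / N := by
        rw [← hNpow]
        field_simp
    _ ≤ E * ((l + 1 + 1 / 2 + 1) ^ (μ + 1 / 2) * (k : ℝ) ^ (μ + 1 / 2)) *
          (k : ℝ) ^ (l - μ + 1 / 2) / N := by gcongr
    _ = E * (l + 1 + 1 / 2 + 1) ^ (μ + 1 / 2) * ((k : ℝ) ^ (l + 1) * k.factorial) /
          (k.factorial * N) := by
        rw [← hkpow]
        field_simp
    _ ≤ (E + 1) * (l + 1 + 1 / 2 + 1) ^ (μ + 1 / 2) * (K * Real.Gamma (l + 1 + k + 1)) /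
          (k.factorial * N) := by
        gcongr ?_ * _ * ?_ / _
        · linarith
        · exact hKle k
    _ = (E + 1) * K * (l + 1 + 1 / 2 + 1) ^ (μ + 1 / 2) / A * (Λ * h) := by
        rw [hΛk]
        field_simp
    _ = Λ * ((E + 1) * K * (l + 1 + 1 / 2 + 1) ^ (μ + 1 / 2) / A * h) := by ring

end coefficients

theorem fourierT_eq_integral_mul_cos {f : ℝ → ℂ} (hfc : Continuous f) (hfi : Integrable f)
    (heven : ∀ t, f (-t) = f t) (ξ : ℝ) :
    fourierT f ξ = ∫ t, f t * (Real.cos (ξ * t) : ℂ) := by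
  have hint : ∀ c : ℝ → ℝ, Continuous c → (∀ t, |c t| ≤ 1) →
      Integrable fun t => f t * (c t : ℂ) := fun c hc hc1 => by
    refine hfi.mono (by fun_prop) (ae_of_all _ fun t => ?_)
    rw [norm_mul, Complex.norm_real]
    exact mul_le_of_le_one_right (norm_nonneg _) (hc1 t)
  have hodd : ∫ t, f t * (Real.sin (ξ * t) : ℂ) = 0 :=
    integral_eq_zero_of_odd fun t => by
      rw [heven, mul_neg, Real.sin_neg, Complex.ofReal_neg, mul_neg]
  have h : ∀ t : ℝ, f t * Complex.exp (-Complex.I * ξ * t) =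
      f t * (Real.cos (ξ * t) : ℂ) - Complex.I * (f t * (Real.sin (ξ * t) : ℂ)) := fun t => by
    rw [show -Complex.I * ξ * t = ((-(ξ * t) : ℝ) : ℂ) * Complex.I by push_cast; ring,
      Complex.exp_mul_I, ← Complex.ofReal_cos, ← Complex.ofReal_sin, Real.cos_neg, Real.sin_neg]
    push_cast
    ring
  rw [fourierT]
  simp only [h]
  rw [integral_sub (hint _ (by fun_prop) fun _ => Real.abs_cos_le_one _)
    ((hint _ (by fun_prop) fun _ => Real.abs_sin_le_one _).const_mul _), integral_const_mul,
    hodd, mul_zero, sub_zero]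

theorem norm_integral_comp_mul_left_mul_cos_le {f : ℝ → ℂ} (hfc : Continuous f)
    (hfi : Integrable f) (heven : ∀ t, f (-t) = f t) {C σ x : ℝ} (hx : 0 < x)
    (hFT : ∀ ξ : ℝ, ξ ≠ 0 → ‖fourierT f ξ‖ ≤ C / |ξ| ^ σ) {ξ : ℝ} (hξ : 0 < ξ) :
    ‖∫ z, f (x * z) * (Real.cos (ξ * z) : ℂ)‖ ≤ C * x ^ σ / x / ξ ^ σ := by
  have h : ∫ z, f (x * z) * (Real.cos (ξ * z) : ℂ) = x⁻¹ • fourierT f (ξ / x) := by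
    have := Measure.integral_comp_mul_left
      (fun t => f t * (Real.cos (ξ / x * t) : ℂ)) x
    rw [abs_of_pos (inv_pos.2 hx)] at this
    rw [fourierT_eq_integral_mul_cos hfc hfi heven, ← this]
    refine integral_congr_ae (ae_of_all _ fun z => ?_)
    simp only
    rw [show ξ / x * (x * z) = ξ * z by field_simp]
  rw [h, norm_smul, Real.norm_of_nonneg (inv_pos.2 hx).le]
  calc x⁻¹ * ‖fourierT f (ξ / x)‖ ≤ x⁻¹ * (C / |ξ / x| ^ σ) := by
        gcongr
        exact hFT _ (by positivity)
    _ = C * x ^ σ / x / ξ ^ σ := by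
        rw [abs_of_pos (by positivity), Real.div_rpow hξ.le hx.le]
        field_simp

theorem betaT_eq_integral {l : ℝ} (hl : -1 ≤ l) (x : ℝ) (f : ℝ → ℂ) (n : ℕ) :
    betaT l x f n = (x / jacobiNormSq l (2 * n) : ℝ) *
      ∫ z in (-1 : ℝ)..1, f (x * z) * (jacobiP (l + 1) (l + 1) (2 * n) z : ℂ) := by
  have hh := jacobiNormSq_pos hl (2 * n)
  set s := Real.sqrt (jacobiNormSq l (2 * n)) with hs
  have hs0 : (s : ℂ) ≠ 0 := Complex.ofReal_ne_zero.2 (Real.sqrt_pos.2 hh).ne'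
  have hss : ((jacobiNormSq l (2 * n) : ℝ) : ℂ) = s * s := by
    rw [← Complex.ofReal_mul, Real.mul_self_sqrt hh.le]
  have hc : cJ l x f (2 * n) =
      (s : ℂ)⁻¹ * ∫ z in (-1 : ℝ)..1, f (x * z) * (jacobiP (l + 1) (l + 1) (2 * n) z : ℂ) := by
    rw [intervalIntegral.integral_of_le (by norm_num), integral_Ioc_eq_integral_Ioo, cJ,
      ← integral_const_mul]
    refine setIntegral_congr_fun measurableSet_Ioo fun z hz => ?_
    have hz0 : 0 < 1 - z ^ 2 := by nlinarith [hz.1, hz.2]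
    have hw : (((1 - z ^ 2) ^ (l + 1) : ℝ) : ℂ) ≠ 0 :=
      Complex.ofReal_ne_zero.2 (Real.rpow_pos_of_pos hz0 _).ne'
    simp only [jacobiPNorm, ← hs]
    rw [Complex.ofReal_mul, Complex.ofReal_div]
    field_simp
  rw [betaT, hc, ← hs, Complex.ofReal_div, hss]
  field_simp

theorem norm_integral_mul_le {G : ℝ → ℂ} (hG : Continuous G) {P : ℝ → ℝ} (hP : Continuous P) :
    ‖∫ z in (-1 : ℝ)..1, G z * (P z : ℂ)‖ ≤
      |∫ z in (-1 : ℝ)..1, (G z).re * P z| + |∫ z in (-1 : ℝ)..1, (G z).im * P z| := by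
  have hint : IntervalIntegrable (fun z => G z * (P z : ℂ)) volume (-1) 1 :=
    Continuous.intervalIntegrable (by fun_prop) _ _
  have hre := Complex.reCLM.intervalIntegral_comp_comm hint
  have him := Complex.imCLM.intervalIntegral_comp_comm hint
  simp only [Complex.reCLM_apply, Complex.imCLM_apply, Complex.re_mul_ofReal,
    Complex.im_mul_ofReal] at hre him
  rw [hre, him]
  exact Complex.norm_le_abs_re_add_abs_im _

/-- pointwise decay of the coefficients `β̃_n`: there is `C₁ > 0` such that
`|β̃_n| ≤ C₁/n^{ℓ-μ+1/2}` for every `n` with `2n > ℓ+1`. -/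
theorem betaT_pointwise_decay
    (l μ x : ℝ) (hl : -(1/2 : ℝ) ≤ l) (hμ0 : 0 ≤ μ) (hμ : μ < 1/2) (hx : 0 < x)
    (f : ℝ → ℂ) (hfc : Continuous f) (hfi : Integrable f)
    (heven : ∀ t : ℝ, f (-t) = f t)
    (hsupp : ∀ t : ℝ, t ∉ Set.Icc (-x) x → f t = 0)
    (C₀ : ℝ) (hC₀ : 0 < C₀)
    (hFT : ∀ ξ : ℝ, ξ ≠ 0 → ‖fourierT f ξ‖ ≤ C₀ / |ξ| ^ (l - μ + 2)) :
    ∃ C₁ : ℝ, 0 < C₁ ∧ ∀ n : ℕ, l + 1 < 2 * (n : ℝ) →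
      ‖betaT l x f n‖ ≤ C₁ / (n : ℝ) ^ (l - μ + 1 / 2) := by
  obtain ⟨K, hK, hdec⟩ := exists_abs_integral_mul_jacobiP_le hl hμ0 hμ
    (D := C₀ * x ^ (l - μ + 2) / x) (by positivity)
  have hGc : Continuous fun z => f (x * z) := by fun_prop
  have hG0 : ∀ z, 1 < |z| → f (x * z) = 0 := fun z hz => hsupp _ fun h => by
    have h1 := abs_le.2 h
    rw [abs_mul, abs_of_pos hx] at h1
    nlinarith
  have hint : ∀ ξ : ℝ, Integrable fun z => f (x * z) * (Real.cos (ξ * z) : ℂ) := fun ξ => by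
    refine (by fun_prop : Continuous _).integrable_of_hasCompactSupport
      (HasCompactSupport.intro (isCompact_Icc (a := (-1 : ℝ)) (b := 1)) fun z hz => ?_)
    rw [hG0 z (not_le.1 fun h => hz (abs_le.1 h)), zero_mul]
  have hcos := fun ξ (hξ : 0 < ξ) => norm_integral_comp_mul_left_mul_cos_le hfc hfi heven hx hFT hξ
  have hre := hdec (fun z => (f (x * z)).re) (by fun_prop) (fun z hz => by rw [hG0 z hz]; rfl)
    (fun z => by rw [mul_neg, heven]) fun ξ hξ => by
      have h := Complex.reCLM.integral_comp_comm (hint ξ)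
      simp only [Complex.reCLM_apply, Complex.re_mul_ofReal] at h
      rw [h]
      exact (Complex.abs_re_le_norm _).trans (hcos ξ hξ)
  have him := hdec (fun z => (f (x * z)).im) (by fun_prop) (fun z hz => by rw [hG0 z hz]; rfl)
    (fun z => by rw [mul_neg, heven]) fun ξ hξ => by
      have h := Complex.imCLM.integral_comp_comm (hint ξ)
      simp only [Complex.imCLM_apply, Complex.im_mul_ofReal] at h
      rw [h]
      exact (Complex.abs_im_le_norm _).trans (hcos ξ hξ)
  refine ⟨x * (2 * (K / 2 ^ (l - μ + 1 / 2))), by positivity, fun n hn => ?_⟩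
  have hn1 : 1 ≤ n := by
    rcases Nat.eq_zero_or_pos n with rfl | h
    · norm_num at hn
      linarith
    · exact h
  have hh := jacobiNormSq_pos (l := l) (by linarith) (2 * n)
  have hr := hre (2 * n) (even_two_mul n) (by omega)
  have hi := him (2 * n) (even_two_mul n) (by omega)
  rw [betaT_eq_integral (by linarith), norm_mul, Complex.norm_real,
    Real.norm_of_nonneg (by positivity)]
  calc _ ≤ x / jacobiNormSq l (2 * n) * _ := mul_le_mul_of_nonneg_left
        (norm_integral_mul_le hGc (continuous_jacobiP (l + 1) (2 * n))) (by positivity)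
    _ = x * (|∫ z in (-1 : ℝ)..1, (f (x * z)).re * jacobiP (l + 1) (l + 1) (2 * n) z| /
            jacobiNormSq l (2 * n) +
          |∫ z in (-1 : ℝ)..1, (f (x * z)).im * jacobiP (l + 1) (l + 1) (2 * n) z| /
            jacobiNormSq l (2 * n)) := by ring
    _ ≤ x * (K / ((2 * n : ℕ) : ℝ) ^ (l - μ + 1 / 2) +
          K / ((2 * n : ℕ) : ℝ) ^ (l - μ + 1 / 2)) := by gcongr
    _ = x * (2 * (K / 2 ^ (l - μ + 1 / 2))) / (n : ℝ) ^ (l - μ + 1 / 2) := by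
        rw [Nat.cast_mul, Nat.cast_two, Real.mul_rpow (by norm_num) n.cast_nonneg]
        field_simp
        ring
end

section
/- Let ℓ ≥ −1/2 be a real number, x > 0, n ∈ ℕ₀, and set n₀ := ⌊ℓ⌋ + 3 (so n₀ > ℓ + 1). For t ∈ (0, x) define F(t) := ∫_t^x (s² − t²)^{n₀−ℓ−2} · s · (1 − s²/x²)^{ℓ+1} · P_{2n}^{(ℓ+1,ℓ+1)}(s/x) ds, and let D be the operator (Dg)(t) := −g′(t)/(2t). Then the n₀-fold iterate D^{n₀}F is well defined on (0, x) and for all t ∈ (0, x): (D^{n₀}F)(t) = ((−1)^n · Γ(n₀−ℓ−1) · Γ(ℓ+2n+2) / (2 · x^{2ℓ+2} · (2n)!)) · P_n^{(ℓ+1/2, 0)}(1 − 2t²/x²). -/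
open MeasureTheory Set Filter

/-- The operator `(Dg)(t) = -g'(t)/(2t)`. -/
noncomputable def Dop (g : ℝ → ℝ) : ℝ → ℝ := fun t => -deriv g t / (2 * t)

/-- `F(t) = ∫_t^x (s²-t²)^{n₀-ℓ-2} s (1-s²/x²)^{ℓ+1} P_{2n}^{(ℓ+1,ℓ+1)}(s/x) ds`
with `n₀ = ⌊ℓ⌋+3`. -/
noncomputable def Fint (l x : ℝ) (n : ℕ) (t : ℝ) : ℝ :=
  ∫ s in Set.Ioo t x,
    (s ^ 2 - t ^ 2) ^ ((((⌊l⌋ + 3).toNat : ℝ)) - l - 2) * s *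
      (1 - s ^ 2 / x ^ 2) ^ (l + 1) * jacobiP (l + 1) (l + 1) (2 * n) (s / x)

section HypergeometricPolynomials

open Polynomial

/-- The hypergeometric differential operator `X(1-X)∂² + (c - sX)∂ - q`. -/
noncomputable def hypergeomOp (s c q : ℝ) (p : ℝ[X]) : ℝ[X] :=
  X * (1 - X) * derivative (derivative p) + (C c - C s * X) * derivative p - C q * p

lemma coeff_hypergeomOp (s c q : ℝ) (p : ℝ[X]) (j : ℕ) :
    (hypergeomOp s c q p).coeff j =
      (j + 1) * (j + c) * p.coeff (j + 1) - (j * (j - 1) + s * j + q) * p.coeff j := by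
  have h : hypergeomOp s c q p = X * derivative (derivative p) - X * (X * derivative (derivative p))
      + C c * derivative p - C s * (X * derivative p) - C q * p := by
    rw [hypergeomOp]; ring
  rw [h]
  rcases j with _ | _ | j
  · simp [coeff_derivative]
  · simp [coeff_derivative, coeff_X_mul]
    ring
  · simp only [coeff_sub, coeff_add, coeff_C_mul, coeff_X_mul, coeff_derivative]
    push_cast
    ring

lemma hypergeomOp_sub (s c q : ℝ) (p r : ℝ[X]) :
    hypergeomOp s c q (p - r) = hypergeomOp s c q p - hypergeomOp s c q r := by
  simp only [hypergeomOp, derivative_sub]; ring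

lemma hypergeomOp_C_mul (s c q b : ℝ) (p : ℝ[X]) :
    hypergeomOp s c q (C b * p) = C b * hypergeomOp s c q p := by
  simp only [hypergeomOp, derivative_C_mul]; ring

/-- A polynomial solution of the hypergeometric equation vanishing at `0` is zero. -/
lemma eq_zero_of_hypergeomOp_of_coeff_zero {s c q : ℝ} (hc : 0 < c) {p : ℝ[X]}
    (hp : hypergeomOp s c q p = 0) (h0 : p.coeff 0 = 0) : p = 0 := by
  ext j
  rw [coeff_zero]
  induction j with
  | zero => exact h0
  | succ j ih =>
    have h := coeff_hypergeomOp s c q p j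
    rw [hp, ih, coeff_zero, mul_zero, sub_zero] at h
    exact (mul_eq_zero.mp h.symm).resolve_left (by positivity)

/-- A polynomial solution of the hypergeometric equation with parameters `-N` and `B > 0` whose
degree is less than `N` is zero. -/
lemma eq_zero_of_hypergeomOp_of_coeff_ge {c B : ℝ} (hB : 0 < B) {N : ℕ} {p : ℝ[X]}
    (hp : hypergeomOp (-N + B + 1) c (-N * B) p = 0) (h : ∀ j, N ≤ j → p.coeff j = 0) :
    p = 0 := by
  by_contra hne
  have hlc : p.coeff p.natDegree ≠ 0 := by simpa using hne
  have hlt : p.natDegree < N := by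
    by_contra! hge
    exact hlc (h _ hge)
  have h1 := coeff_hypergeomOp (-N + B + 1) c (-N * B) p p.natDegree
  rw [hp, coeff_zero, coeff_eq_zero_of_natDegree_lt (Nat.lt_succ_self _), mul_zero, zero_sub,
    zero_eq_neg, mul_eq_zero] at h1
  rcases h1 with h1 | h1
  · have hlt' : (p.natDegree : ℝ) < N := by exact_mod_cast hlt
    have : ((p.natDegree : ℝ) - N) * (p.natDegree + B) = 0 := by linear_combination h1
    rcases mul_eq_zero.mp this with h2 | h2
    · linarith
    · have : 0 < (p.natDegree : ℝ) + B := by positivity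
      exact this.ne' h2
  · exact hlc h1

/-- The coefficients of `(Γ(B)/Γ(c)) ₂F₁(-N, B; c; ·)`. -/
noncomputable def hypergeomCoeff (N : ℕ) (B c : ℝ) (k : ℕ) : ℝ :=
  (N.choose k : ℝ) * (-1) ^ k * (Real.Gamma (B + k) / Real.Gamma (c + k))

/-- The polynomial `(Γ(B)/Γ(c)) ₂F₁(-N, B; c; X)`. -/
noncomputable def hypergeomPoly (N : ℕ) (B c : ℝ) : ℝ[X] :=
  ∑ k ∈ Finset.range (N + 1), C (hypergeomCoeff N B c k) * X ^ k

lemma coeff_hypergeomPoly (N : ℕ) (B c : ℝ) (j : ℕ) :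
    (hypergeomPoly N B c).coeff j = hypergeomCoeff N B c j := by
  simp only [hypergeomPoly, finsetSum_coeff, coeff_C_mul, coeff_X_pow, mul_ite, mul_one, mul_zero,
    Finset.sum_ite_eq, Finset.mem_range]
  split_ifs with h
  · rfl
  · rw [hypergeomCoeff, Nat.choose_eq_zero_of_lt (by omega)]
    simp

lemma hypergeomCoeff_succ {B c : ℝ} (hB : 0 < B) (hc : 0 < c) (N k : ℕ) :
    (k + 1) * (k + c) * hypergeomCoeff N B c (k + 1) =
      (k - N) * (k + B) * hypergeomCoeff N B c k := by
  have h1 : Real.Gamma (B + (k + 1 : ℕ)) = (B + k) * Real.Gamma (B + k) := by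
    rw [← Real.Gamma_add_one (by positivity)]; push_cast; ring_nf
  have h2 : Real.Gamma (c + (k + 1 : ℕ)) = (c + k) * Real.Gamma (c + k) := by
    rw [← Real.Gamma_add_one (by positivity)]; push_cast; ring_nf
  have h3 : ((N.choose (k + 1) : ℕ) : ℝ) * (k + 1) = N.choose k * (N - k) := by
    rcases le_or_gt k N with h | h
    · have := Nat.choose_succ_right_eq N k
      rw [← Nat.cast_sub h]
      exact_mod_cast this
    · rw [Nat.choose_eq_zero_of_lt h, Nat.choose_eq_zero_of_lt (by omega)]
      simp
  have h4 : 0 < Real.Gamma (c + k) := Real.Gamma_pos_of_pos (by positivity)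
  have h5 : 0 < c + k := by positivity
  rw [hypergeomCoeff, hypergeomCoeff, h1, h2]
  have h6 : (B + k) * Real.Gamma (B + k) / ((c + k) * Real.Gamma (c + k)) * (c + k) =
      (B + k) * (Real.Gamma (B + k) / Real.Gamma (c + k)) := by
    field_simp
  generalize Real.Gamma (B + k) / Real.Gamma (c + k) = g at *
  rw [pow_succ]
  linear_combination (-(-1) ^ k * (N.choose (k + 1) : ℝ) * (k + 1)) * h6
    - ((-1) ^ k * (B + k) * g) * h3

lemma hypergeomOp_hypergeomPoly {B c : ℝ} (hB : 0 < B) (hc : 0 < c) (N : ℕ) :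
    hypergeomOp (-N + B + 1) c (-N * B) (hypergeomPoly N B c) = 0 := by
  ext j
  rw [coeff_hypergeomOp, coeff_hypergeomPoly, coeff_hypergeomPoly, coeff_zero,
    hypergeomCoeff_succ hB hc]
  ring

lemma hypergeomOp_comp_one_sub (s c q : ℝ) (p : ℝ[X]) :
    hypergeomOp s (s - c) q (p.comp (1 - X)) = (hypergeomOp s c q p).comp (1 - X) := by
  simp only [hypergeomOp, derivative_comp, derivative_mul, derivative_sub, derivative_one,
    derivative_X, sub_comp, add_comp, mul_comp, C_comp, X_comp, one_comp, C_sub, derivative_zero]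
  ring

lemma hypergeomOp_comp_quadratic (c q : ℝ) (p : ℝ[X]) :
    hypergeomOp (2 * c) c (4 * q) (p.comp (C 4 * (X - X ^ 2))) =
      C 4 * (hypergeomOp (c + 1 / 2) c q p).comp (C 4 * (X - X ^ 2)) := by
  have h2 : (C (1 / 2 : ℝ) : ℝ[X]) * 2 = 1 := by
    rw [← C_ofNat, ← C_mul]; norm_num
  have hd : derivative (C (4 : ℝ) * (X - X ^ 2)) = 4 * (1 - 2 * X) := by
    simp [C_ofNat, one_add_one_eq_two]
  have hdd : derivative (4 * (1 - 2 * X) : ℝ[X]) = -8 := by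
    rw [show (4 * (1 - 2 * X) : ℝ[X]) = C 4 - C 8 * X by simp only [C_ofNat]; ring]
    simp [C_ofNat]
  simp only [hypergeomOp, derivative_comp, derivative_mul, sub_comp,
    add_comp, mul_comp, C_comp, X_comp, one_comp, C_add, C_mul, hd]
  rw [← derivative_mul, hdd]
  simp only [C_ofNat]
  linear_combination (8 * (X - X ^ 2) * (derivative p).comp (4 * (X - X ^ 2))) * h2

/-- Quadratic transformation of terminating hypergeometric series. -/
lemma hypergeomPoly_quadratic {a : ℝ} (ha : -(1 / 2) < a) (n : ℕ) :
    C (Real.Gamma (n + a + 1 / 2)) * hypergeomPoly (2 * n) (2 * n + 2 * a + 1) (a + 1) =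
      C (Real.Gamma (2 * n + 2 * a + 1)) *
        (hypergeomPoly n (n + a + 1 / 2) (a + 1)).comp (C 4 * (X - X ^ 2)) := by
  have hn : (0 : ℝ) ≤ n := Nat.cast_nonneg n
  rw [← sub_eq_zero]
  have h1 := hypergeomOp_hypergeomPoly (B := 2 * n + 2 * a + 1) (c := a + 1) (by linarith)
    (by linarith) (2 * n)
  have h2 := hypergeomOp_hypergeomPoly (B := n + a + 1 / 2) (c := a + 1) (by linarith)
    (by linarith) n
  refine eq_zero_of_hypergeomOp_of_coeff_zero (c := a + 1) (s := 2 * (a + 1))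
    (q := 4 * (-n * (n + a + 1 / 2))) (by linarith) ?_ ?_
  · rw [hypergeomOp_sub, hypergeomOp_C_mul, hypergeomOp_C_mul, hypergeomOp_comp_quadratic]
    rw [show (-n + (n + a + 1 / 2) + 1 : ℝ) = a + 1 + 1 / 2 by ring] at h2
    rw [show (-(2 * n : ℕ) + (2 * n + 2 * a + 1) + 1 : ℝ) = 2 * (a + 1) by push_cast; ring,
      show (-(2 * n : ℕ) * (2 * n + 2 * a + 1) : ℝ) = 4 * (-n * (n + a + 1 / 2)) by
        push_cast; ring] at h1
    rw [h1, h2]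
    simp
  · rw [coeff_sub, coeff_C_mul, coeff_C_mul, coeff_hypergeomPoly, coeff_zero_eq_eval_zero (comp _ _),
      eval_comp]
    simp only [eval_mul, eval_C, eval_sub, eval_X, eval_pow, ne_eq, OfNat.ofNat_ne_zero,
      not_false_eq_true, zero_pow, sub_zero, mul_zero]
    rw [← coeff_zero_eq_eval_zero, coeff_hypergeomPoly]
    simp [hypergeomCoeff]
    ring

/-- Reflection `w ↦ 1 - w` of terminating hypergeometric series. -/
lemma hypergeomPoly_reflect {a : ℝ} (ha : -1 < a) (n : ℕ) :
    C (Real.Gamma (a + n + 1)) * (hypergeomPoly n (a + n + 1) (a + 1)).comp (1 - X) =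
      C ((-1) ^ n * (n.factorial : ℝ)) * hypergeomPoly n (a + n + 1) 1 := by
  have hn : (0 : ℝ) ≤ n := Nat.cast_nonneg n
  have hB : 0 < a + n + 1 := by linarith
  have hc : 0 < a + 1 := by linarith
  rw [← sub_eq_zero]
  refine eq_zero_of_hypergeomOp_of_coeff_ge (c := 1) hB (N := n) ?_ ?_
  · rw [hypergeomOp_sub, hypergeomOp_C_mul, hypergeomOp_C_mul,
      hypergeomOp_hypergeomPoly hB one_pos]
    have h := hypergeomOp_comp_one_sub (-n + (a + n + 1) + 1) (a + 1) (-n * (a + n + 1))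
      (hypergeomPoly n (a + n + 1) (a + 1))
    rw [hypergeomOp_hypergeomPoly hB hc,
      show (-n + (a + n + 1) + 1 - (a + 1) : ℝ) = 1 by ring] at h
    rw [h]
    simp
  · have hdeg : (hypergeomPoly n (a + n + 1) (a + 1)).natDegree = n := by
      refine natDegree_eq_of_le_of_coeff_ne_zero ?_ ?_
      · rw [natDegree_le_iff_coeff_eq_zero]
        intro j hj
        rw [coeff_hypergeomPoly, hypergeomCoeff, Nat.choose_eq_zero_of_lt hj]
        simp
      · rw [coeff_hypergeomPoly, hypergeomCoeff]
        have h1 := Real.Gamma_pos_of_pos (show 0 < a + n + 1 + n by linarith)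
        have h2 := Real.Gamma_pos_of_pos (show 0 < a + 1 + n by linarith)
        simp [h1.ne', h2.ne']
    have hX : (1 - X : ℝ[X]) = C (-1) * X + C 1 := by simp; ring
    have hX1 : (1 - X : ℝ[X]).natDegree = 1 := by
      rw [hX]; exact natDegree_linear (by norm_num)
    have hX2 : (1 - X : ℝ[X]).leadingCoeff = -1 := by
      rw [hX]; exact leadingCoeff_linear (by norm_num)
    intro j hj
    rcases hj.eq_or_lt with rfl | hj
    · have h := coeff_comp_degree_mul_degree (p := hypergeomPoly n (a + n + 1) (a + 1))
        (q := (1 - X : ℝ[X])) (by rw [hX1]; norm_num)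
      rw [leadingCoeff, hdeg, hX1, hX2, mul_one, coeff_hypergeomPoly] at h
      rw [coeff_sub, coeff_C_mul, coeff_C_mul, h, coeff_hypergeomPoly, hypergeomCoeff,
        hypergeomCoeff, add_comm (1 : ℝ) n, Real.Gamma_nat_eq_factorial]
      have h2 := Real.Gamma_pos_of_pos hB
      have h3 : (n.factorial : ℝ) ≠ 0 := by positivity
      rw [show a + 1 + n = a + n + 1 by ring]
      field_simp
      ring
    · rw [coeff_sub, coeff_C_mul, coeff_C_mul, coeff_hypergeomPoly, hypergeomCoeff,
        Nat.choose_eq_zero_of_lt hj, coeff_eq_zero_of_natDegree_lt]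
      · simp
      · exact natDegree_comp_le.trans_lt (by rw [hdeg, hX1]; omega)

end HypergeometricPolynomials

lemma integral_rpow_mul_one_sub_rpow {p q : ℝ} (hp : -1 < p) (hq : -1 < q) :
    ∫ r in (0 : ℝ)..1, r ^ p * (1 - r) ^ q =
      Real.Gamma (p + 1) * Real.Gamma (q + 1) / Real.Gamma (p + q + 2) := by
  have h := ProbabilityTheory.beta_eq_betaIntegralReal (p + 1) (q + 1) (by linarith) (by linarith)
  rw [ProbabilityTheory.beta, show p + 1 + (q + 1) = p + q + 2 by ring] at h
  rw [h, Complex.betaIntegral, ← Complex.ofReal_re (∫ r in (0 : ℝ)..1, r ^ p * (1 - r) ^ q),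
    ← intervalIntegral.integral_ofReal]
  congr 1
  refine intervalIntegral.integral_congr fun r hr => ?_
  rw [uIcc_of_le zero_le_one] at hr
  push_cast
  rw [Complex.ofReal_cpow hr.1, Complex.ofReal_cpow (by linarith [hr.2])]
  simp

lemma integral_sq_sub_sq_rpow {t x p q : ℝ} (ht : 0 < t) (htx : t < x) (hp : 0 ≤ p) (hq : 0 ≤ q) :
    ∫ s in Ioo t x, (s ^ 2 - t ^ 2) ^ p * s * (1 - s ^ 2 / x ^ 2) ^ q =
      Real.Gamma (p + 1) * Real.Gamma (q + 1) / Real.Gamma (p + q + 2) / 2 *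
        (x ^ 2 - t ^ 2) ^ (p + q + 1) / (x ^ 2) ^ q := by
  have hx : 0 < x := ht.trans htx
  obtain ⟨L, hL⟩ : ∃ L, L = x ^ 2 - t ^ 2 := ⟨_, rfl⟩
  have hL0 : 0 < L := by rw [hL]; nlinarith
  have hsub := intervalIntegral.integral_comp_mul_deriv (a := t) (b := x)
    (f := fun s => (s ^ 2 - t ^ 2) / L) (f' := fun s => 2 * s / L)
    (g := fun r => (r * L) ^ p * ((1 - r) * L / x ^ 2) ^ q * (L / 2))
    (fun s _ => by
      have := (((hasDerivAt_id s).pow 2).sub_const (t ^ 2)).div_const L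
      simpa using this)
    (by fun_prop)
    (by
      refine Continuous.mul (Continuous.mul ?_ ?_) continuous_const
      · exact (by fun_prop : Continuous fun r : ℝ => r * L).rpow_const fun _ => Or.inr hp
      · exact (by fun_prop : Continuous fun r : ℝ => (1 - r) * L / x ^ 2).rpow_const
          fun _ => Or.inr hq)
  have hf0 : (t ^ 2 - t ^ 2) / L = 0 := by simp
  have hf1 : (x ^ 2 - t ^ 2) / L = 1 := by rw [← hL, div_self hL0.ne']
  simp only [hf0, hf1] at hsub
  rw [← integral_Ioc_eq_integral_Ioo, ← intervalIntegral.integral_of_le htx.le, ← hL]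
  calc ∫ s in t..x, (s ^ 2 - t ^ 2) ^ p * s * (1 - s ^ 2 / x ^ 2) ^ q
      = _ := intervalIntegral.integral_congr fun s _ => ?_
    _ = _ := hsub
    _ = ∫ r in (0 : ℝ)..1, (L ^ (p + q + 1) / (x ^ 2) ^ q / 2) * (r ^ p * (1 - r) ^ q) :=
      intervalIntegral.integral_congr fun r hr => ?_
    _ = _ := by
      rw [intervalIntegral.integral_const_mul,
        integral_rpow_mul_one_sub_rpow (by linarith) (by linarith)]
      ring
  · have h1 : (s ^ 2 - t ^ 2) / L * L = s ^ 2 - t ^ 2 := by field_simp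
    have h2 : (1 - (s ^ 2 - t ^ 2) / L) * L / x ^ 2 = 1 - s ^ 2 / x ^ 2 := by
      field_simp
      rw [hL]; ring
    simp only [Function.comp_apply, h1, h2]
    field_simp
  · rw [uIcc_of_le zero_le_one] at hr
    have hr1 : 0 ≤ 1 - r := by linarith [hr.2]
    rw [Real.mul_rpow hr.1 hL0.le, Real.div_rpow (by positivity) (by positivity),
      Real.mul_rpow hr1 hL0.le, Real.rpow_add hL0, Real.rpow_add hL0, Real.rpow_one]
    ring

lemma Dop_iterate_eqOn {x : ℝ} {N m : ℕ} {b : ℕ → ℝ} {g : ℝ → ℝ}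
    (hg : EqOn g (fun t => ∑ k ∈ Finset.range N, b k * (x ^ 2 - t ^ 2) ^ (m + k)) (Ioo 0 x))
    {j : ℕ} :
    EqOn (Dop^[j] g) (fun t => ∑ k ∈ Finset.range N,
      b k * ((m + k).descFactorial j : ℝ) * (x ^ 2 - t ^ 2) ^ (m + k - j)) (Ioo 0 x) := by
  induction j with
  | zero => simpa using hg
  | succ j ih =>
    intro t ht
    have hd : HasDerivAt (Dop^[j] g) (∑ k ∈ Finset.range N,
        b k * ((m + k).descFactorial j : ℝ) *
          ((m + k - j : ℕ) * (x ^ 2 - t ^ 2) ^ (m + k - j - 1) * -(2 * t))) t := by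
      refine HasDerivAt.congr_of_eventuallyEq ?_ (ih.eventuallyEq_of_mem (Ioo_mem_nhds ht.1 ht.2))
      refine HasDerivAt.fun_sum fun k _ => HasDerivAt.const_mul _ ?_
      have := (((hasDerivAt_id t).fun_pow 2).const_sub (x ^ 2)).fun_pow (m + k - j)
      simpa using this
    rw [Function.iterate_succ_apply', Dop, hd.deriv, ← Finset.sum_neg_distrib, Finset.sum_div]
    refine Finset.sum_congr rfl fun k _ => ?_
    have ht0 : t ≠ 0 := ht.1.ne'
    rw [Nat.descFactorial_succ, Nat.cast_mul, ← Nat.sub_sub]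
    field_simp

lemma differentiableAt_Dop_iterate {x : ℝ} {N m : ℕ} {b : ℕ → ℝ} {g : ℝ → ℝ}
    (hg : EqOn g (fun t => ∑ k ∈ Finset.range N, b k * (x ^ 2 - t ^ 2) ^ (m + k)) (Ioo 0 x))
    (j : ℕ) {t : ℝ} (ht : t ∈ Ioo 0 x) : DifferentiableAt ℝ (Dop^[j] g) t := by
  refine DifferentiableAt.congr_of_eventuallyEq ?_
    ((Dop_iterate_eqOn hg (j := j)).eventuallyEq_of_mem (Ioo_mem_nhds ht.1 ht.2))
  fun_prop

lemma jacobiP_eq_hypergeomPoly_eval (a b : ℝ) (n : ℕ) (z : ℝ) :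
    jacobiP a b n z = Real.Gamma (a + n + 1) / (n.factorial * Real.Gamma (a + b + n + 1)) *
      (hypergeomPoly n (a + b + n + 1) (a + 1)).eval ((1 - z) / 2) := by
  rw [jacobiP, hypergeomPoly, Polynomial.eval_finsetSum]
  congr 1
  refine Finset.sum_congr rfl fun k _ => ?_
  rw [Polynomial.eval_C_mul, Polynomial.eval_X_pow, hypergeomCoeff,
    show (z - 1) / 2 = (-1) * ((1 - z) / 2) by ring, mul_pow,
    show a + b + n + 1 + k = a + b + n + k + 1 by ring, add_right_comm a 1 (k : ℝ)]
  ring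

/-- The even-degree ultraspherical polynomial as a polynomial in `1 - y²`. -/
lemma jacobiP_two_mul {a : ℝ} (ha : -(1 / 2) < a) (n : ℕ) (y : ℝ) :
    jacobiP a a (2 * n) y =
      Real.Gamma (a + 2 * n + 1) / ((2 * n).factorial * Real.Gamma (n + a + 1 / 2)) *
        ∑ k ∈ Finset.range (n + 1),
          hypergeomCoeff n (n + a + 1 / 2) (a + 1) k * (1 - y ^ 2) ^ k := by
  have hn : (0 : ℝ) ≤ n := Nat.cast_nonneg n
  have h := congrArg (Polynomial.eval ((1 - y) / 2)) (hypergeomPoly_quadratic ha n)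
  rw [Polynomial.eval_C_mul, Polynomial.eval_C_mul, Polynomial.eval_comp] at h
  simp only [Polynomial.eval_mul, Polynomial.eval_C, Polynomial.eval_sub, Polynomial.eval_X,
    Polynomial.eval_pow] at h
  rw [show 4 * ((1 - y) / 2 - ((1 - y) / 2) ^ 2) = 1 - y ^ 2 by ring] at h
  have hs : (hypergeomPoly n (n + a + 1 / 2) (a + 1)).eval (1 - y ^ 2) =
      ∑ k ∈ Finset.range (n + 1),
          hypergeomCoeff n (n + a + 1 / 2) (a + 1) k * (1 - y ^ 2) ^ k := by
    simp [hypergeomPoly, Polynomial.eval_finsetSum]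
  rw [← hs, jacobiP_eq_hypergeomPoly_eval]
  push_cast
  rw [show a + a + 2 * n + 1 = 2 * n + 2 * a + 1 by ring]
  have h1 := Real.Gamma_pos_of_pos (show 0 < n + a + 1 / 2 by linarith)
  have h2 := Real.Gamma_pos_of_pos (show 0 < 2 * n + 2 * a + 1 by linarith)
  generalize Real.Gamma (n + a + 1 / 2) = G1, Real.Gamma (2 * n + 2 * a + 1) = G2,
    Polynomial.eval _ (hypergeomPoly n _ _) = e1,
    Polynomial.eval _ (hypergeomPoly (2 * n) _ _) = e2 at *
  field_simp
  linear_combination Real.Gamma (a + 2 * n + 1) * h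

lemma jacobiP_zero_right {a : ℝ} (ha : -1 < a) (n : ℕ) (w : ℝ) :
    jacobiP a 0 n (2 * w - 1) = (-1) ^ n / Real.Gamma (a + n + 1) *
      ∑ k ∈ Finset.range (n + 1), hypergeomCoeff n (a + n + 1) 1 k * w ^ k := by
  have hn : (0 : ℝ) ≤ n := Nat.cast_nonneg n
  have h := congrArg (Polynomial.eval w) (hypergeomPoly_reflect ha n)
  rw [Polynomial.eval_C_mul, Polynomial.eval_C_mul, Polynomial.eval_comp] at h
  simp only [Polynomial.eval_sub, Polynomial.eval_X, Polynomial.eval_one] at h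
  have hs : (hypergeomPoly n (a + n + 1) 1).eval w =
      ∑ k ∈ Finset.range (n + 1), hypergeomCoeff n (a + n + 1) 1 k * w ^ k := by
    simp [hypergeomPoly, Polynomial.eval_finsetSum]
  rw [← hs, jacobiP_eq_hypergeomPoly_eval, add_zero,
    show (1 - (2 * w - 1)) / 2 = 1 - w by ring]
  have h1 := Real.Gamma_pos_of_pos (show 0 < a + n + 1 by linarith)
  field_simp
  linear_combination h

lemma Fint_eqOn {l x : ℝ} (hl : -(1 / 2) ≤ l) {m : ℕ} (hm : (⌊l⌋ + 3).toNat = m)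
    (hml : l + 2 ≤ m) (n : ℕ) :
    EqOn (Fint l x n) (fun t => ∑ k ∈ Finset.range (n + 1),
      (Real.Gamma (l + 2 * n + 2) / ((2 * n).factorial * Real.Gamma (n + l + 3 / 2)) *
        hypergeomCoeff n (n + l + 3 / 2) (l + 2) k *
        (Real.Gamma (m - l - 1) * Real.Gamma (l + k + 2) / (m + k).factorial / 2 /
          (x ^ 2) ^ (l + 1 + k))) * (x ^ 2 - t ^ 2) ^ (m + k)) (Ioo 0 x) := by
  intro t ht
  have hint (k : ℕ) : IntegrableOn (fun s => (s ^ 2 - t ^ 2) ^ (m - l - 2) * s *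
      (1 - s ^ 2 / x ^ 2) ^ (l + 1 + k)) (Ioo t x) := by
    refine Continuous.integrableOn_Icc (a := t) (b := x) ?_ |>.mono_set Ioo_subset_Icc_self
    refine ((Continuous.rpow_const (by fun_prop) fun _ => Or.inr (by linarith)).mul
      continuous_id).mul (Continuous.rpow_const (by fun_prop) fun _ => Or.inr ?_)
    have : (0 : ℝ) ≤ k := Nat.cast_nonneg k
    linarith
  have hcong : ∀ s ∈ Ioo t x, (s ^ 2 - t ^ 2) ^ (m - l - 2) * s *
      (1 - s ^ 2 / x ^ 2) ^ (l + 1) * jacobiP (l + 1) (l + 1) (2 * n) (s / x) =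
      ∑ k ∈ Finset.range (n + 1),
        (Real.Gamma (l + 2 * n + 2) / ((2 * n).factorial * Real.Gamma (n + l + 3 / 2)) *
          hypergeomCoeff n (n + l + 3 / 2) (l + 2) k) *
        ((s ^ 2 - t ^ 2) ^ (m - l - 2) * s * (1 - s ^ 2 / x ^ 2) ^ (l + 1 + k)) := by
    intro s hs
    have hpos : 0 < 1 - s ^ 2 / x ^ 2 := by
      have hx : 0 < x := ht.1.trans ht.2
      rw [sub_pos, div_lt_one (by positivity)]
      nlinarith [hs.1, hs.2, ht.1]
    rw [jacobiP_two_mul (by linarith), Finset.mul_sum, Finset.mul_sum]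
    refine Finset.sum_congr rfl fun k _ => ?_
    rw [Real.rpow_add_natCast hpos.ne', div_pow,
      show l + 1 + 2 * n + 1 = l + 2 * n + 2 by ring,
      show n + (l + 1) + 1 / 2 = n + l + 3 / 2 by ring, show l + 1 + 1 = l + 2 by ring]
    ring
  rw [Fint, hm, setIntegral_congr_fun measurableSet_Ioo hcong,
    integral_finsetSum _ fun k _ => (hint k).const_mul _]
  refine Finset.sum_congr rfl fun k _ => ?_
  have hk : (0 : ℝ) ≤ k := Nat.cast_nonneg k
  rw [integral_const_mul, integral_sq_sub_sq_rpow ht.1 ht.2 (by linarith) (by linarith),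
    show m - l - 2 + (l + 1 + k) + 2 = ((m + k : ℕ) : ℝ) + 1 by push_cast; ring,
    show m - l - 2 + (l + 1 + k) + 1 = ((m + k : ℕ) : ℝ) by push_cast; ring,
    Real.Gamma_nat_eq_factorial, Real.rpow_natCast,
    show m - l - 2 + 1 = m - l - 1 by ring, show l + 1 + k + 1 = l + k + 2 by ring]
  ring

/-- the `n₀`-fold iterate of `D`, `n₀ = ⌊ℓ⌋+3 > ℓ+1`, applied to `F`
is well defined on `(0,x)` (each intermediate iterate is differentiable there) and
`(D^{n₀}F)(t) = ((-1)^n Γ(n₀-ℓ-1) Γ(ℓ+2n+2) / (2 x^{2ℓ+2} (2n)!)) P_n^{(ℓ+1/2,0)}(1-2t²/x²)`. -/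
theorem iterated_D_of_jacobi_term
    (l x : ℝ) (hl : -(1/2 : ℝ) ≤ l) (hx : 0 < x) (n : ℕ) :
    (∀ k : ℕ, k < (⌊l⌋ + 3).toNat → ∀ t ∈ Set.Ioo (0 : ℝ) x,
      DifferentiableAt ℝ (Dop^[k] (Fint l x n)) t) ∧
    (∀ t ∈ Set.Ioo (0 : ℝ) x,
      (Dop^[(⌊l⌋ + 3).toNat] (Fint l x n)) t =
        ((-1 : ℝ) ^ n * Real.Gamma ((((⌊l⌋ + 3).toNat : ℝ)) - l - 1) *
            Real.Gamma (l + 2 * n + 2) /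
          (2 * x ^ (2 * l + 2) * ((2 * n).factorial : ℝ))) *
        jacobiP (l + 1 / 2) 0 n (1 - 2 * t ^ 2 / x ^ 2)) := by
  have hn : (0 : ℝ) ≤ n := Nat.cast_nonneg n
  obtain ⟨m, hm⟩ : ∃ m, (⌊l⌋ + 3).toNat = m := ⟨_, rfl⟩
  have hml : l + 2 ≤ m := by
    have h1 : (-1 : ℤ) ≤ ⌊l⌋ := Int.le_floor.mpr (by push_cast; linarith)
    have h2 : (m : ℤ) = ⌊l⌋ + 3 := by omega
    have h3 : (m : ℝ) = ⌊l⌋ + 3 := by exact_mod_cast h2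
    linarith [Int.lt_floor_add_one l]
  have hF := Fint_eqOn (x := x) hl hm hml n
  rw [hm]
  refine ⟨fun k _ t ht => differentiableAt_Dop_iterate hF k ht, fun t ht => ?_⟩
  rw [Dop_iterate_eqOn hF ht,
    show 1 - 2 * t ^ 2 / x ^ 2 = 2 * ((x ^ 2 - t ^ 2) / x ^ 2) - 1 by field_simp; ring,
    jacobiP_zero_right (by linarith), Finset.mul_sum, Finset.mul_sum]
  refine Finset.sum_congr rfl fun k _ => ?_
  have hk : (0 : ℝ) ≤ k := Nat.cast_nonneg k
  have hx2 : (x ^ 2) ^ (l + 1 + k) = x ^ (2 * l + 2) * (x ^ 2) ^ k := by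
    rw [Real.rpow_add_natCast (by positivity), ← Real.rpow_natCast x 2, ← Real.rpow_mul hx.le]
    push_cast
    ring_nf
  have hfac : ((m + k).factorial : ℝ) = k.factorial * (m + k).descFactorial m := by
    have h := Nat.factorial_mul_descFactorial (Nat.le_add_right m k)
    rw [Nat.add_sub_cancel_left] at h
    exact_mod_cast h.symm
  have hdesc : ((m + k).descFactorial m : ℝ) ≠ 0 := by
    intro h0
    rw [h0, mul_zero] at hfac
    exact (m + k).factorial_ne_zero (by exact_mod_cast hfac)
  have hG1 := Real.Gamma_pos_of_pos (show 0 < l + k + 2 by linarith)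
  have hG2 := Real.Gamma_pos_of_pos (show 0 < n + l + 3 / 2 by linarith)
  have hxp : 0 < x ^ (2 * l + 2) := Real.rpow_pos_of_pos hx _
  have hsign : ((-1 : ℝ) ^ n) * (-1) ^ n = 1 := by rw [← mul_pow]; simp
  rw [hx2, hfac, Nat.add_sub_cancel_left, div_pow, hypergeomCoeff, hypergeomCoeff,
    show l + 1 / 2 + n + 1 = n + l + 3 / 2 by ring, add_right_comm l 2 (k : ℝ),
    add_comm (1 : ℝ) k, Real.Gamma_nat_eq_factorial]
  have hkf : (k.factorial : ℝ) ≠ 0 := by positivity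
  generalize Real.Gamma (n + l + 3 / 2) = G2, Real.Gamma (n + l + 3 / 2 + k) = G3 at *
  field_simp
  rw [show ((-1 : ℝ) ^ n) ^ 2 = 1 by rw [sq, hsign]]
  ring
end
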